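/- The satisfiability problem over products of ⟨ω,<⟩ with difference frames is Σ₁¹-complete: the set of bimodal formulas that are satisfied in some model based on a product frame ⟨ω,<⟩ × ⟨W,≠⟩ with ⟨W,≠⟩ a difference frame is Σ₁¹-complete with respect to computable many-one reducibility in the analytical hierarchy (in particular, the counter-machine recurrence problem — given a counter machine M and states q₀, q_r, does M have an infinite run starting with ⟨q₀,𝟎⟩ and visiting q_r infinitely often — is computably many-one reducible to it, and the problem itself is Σ₁¹-definable). -/

import Mathlib

namespace HK

/-! ## Bimodal formulas -/

/-- Bimodal formulas: `φ ::= P | ¬φ | φ∧ψ | ◇₀φ | ◇₁φ`. -/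
inductive BForm : Type
  | var : ℕ → BForm
  | neg : BForm → BForm
  | and : BForm → BForm → BForm
  | dia0 : BForm → BForm
  | dia1 : BForm → BForm

namespace BForm

def imp (φ ψ : BForm) : BForm := neg (and φ (neg ψ))
def bot : BForm := and (var 0) (neg (var 0))
def top : BForm := neg bot
def box0 (φ : BForm) : BForm := neg (dia0 (neg φ))
def box1 (φ : BForm) : BForm := neg (dia1 (neg φ))
/-- `□₀⁺φ := φ ∧ □₀φ` -/
def boxP0 (φ : BForm) : BForm := and φ (box0 φ)
/-- `□₁⁺φ := φ ∧ □₁φ` -/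
def boxP1 (φ : BForm) : BForm := and φ (box1 φ)

/-- Modal nesting depth. -/
def depth : BForm → ℕ
  | var _ => 0
  | neg φ => depth φ
  | and φ ψ => max (depth φ) (depth ψ)
  | dia0 φ => depth φ + 1
  | dia1 φ => depth φ + 1

/-- The propositional variable `k` occurs in the formula. -/
def Occurs (k : ℕ) : BForm → Prop
  | var n => k = n
  | neg φ => Occurs k φ
  | and φ ψ => Occurs k φ ∨ Occurs k ψ
  | dia0 φ => Occurs k φ
  | dia1 φ => Occurs k φ

/-- The formula uses only the modal operator `◇₀`. -/
def OnlyDia0 : BForm → Prop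
  | var _ => True
  | neg φ => OnlyDia0 φ
  | and φ ψ => OnlyDia0 φ ∧ OnlyDia0 ψ
  | dia0 φ => OnlyDia0 φ
  | dia1 _ => False

/-- The formula uses only the modal operator `◇₁`. -/
def OnlyDia1 : BForm → Prop
  | var _ => True
  | neg φ => OnlyDia1 φ
  | and φ ψ => OnlyDia1 φ ∧ OnlyDia1 ψ
  | dia0 _ => False
  | dia1 φ => OnlyDia1 φ

/-- Relativisation `φ^D` of each diamond to the variable `d`:
each subformula `◇ᵢψ` is replaced by `◇ᵢ(D ∧ ψ^D)`. -/
def relativize (d : ℕ) : BForm → BForm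
  | var n => var n
  | neg φ => neg (relativize d φ)
  | and φ ψ => and (relativize d φ) (relativize d ψ)
  | dia0 φ => dia0 (and (var d) (relativize d φ))
  | dia1 φ => dia1 (and (var d) (relativize d φ))

/-- `□₀^k φ` -/
def iterBox0 : ℕ → BForm → BForm
  | 0, φ => φ
  | n+1, φ => box0 (iterBox0 n φ)

/-- `□₁^k φ` -/
def iterBox1 : ℕ → BForm → BForm
  | 0, φ => φ
  | n+1, φ => box1 (iterBox1 n φ)

/-- `□₀^{≤n} φ := ⋀_{k ≤ n} □₀^k φ` -/
def boxLe0 : ℕ → BForm → BForm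
  | 0, φ => φ
  | n+1, φ => and (boxLe0 n φ) (iterBox0 (n+1) φ)

/-- `□₁^{≤n} φ := ⋀_{k ≤ n} □₁^k φ` -/
def boxLe1 : ℕ → BForm → BForm
  | 0, φ => φ
  | n+1, φ => and (boxLe1 n φ) (iterBox1 (n+1) φ)

/-- Uniform substitution. -/
def subst (s : ℕ → BForm) : BForm → BForm
  | var n => s n
  | neg φ => neg (subst s φ)
  | and φ ψ => and (subst s φ) (subst s ψ)
  | dia0 φ => dia0 (subst s φ)
  | dia1 φ => dia1 (subst s φ)

end BForm

/-- Kripke truth over a 2-frame `⟨W, R0, R1⟩` with valuation `val`. -/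
def BSat {W : Type} (R0 R1 : W → W → Prop) (val : ℕ → W → Prop) : W → BForm → Prop
  | w, .var n => val n w
  | w, .neg φ => ¬ BSat R0 R1 val w φ
  | w, .and φ ψ => BSat R0 R1 val w φ ∧ BSat R0 R1 val w ψ
  | w, .dia0 φ => ∃ v, R0 w v ∧ BSat R0 R1 val v φ
  | w, .dia1 φ => ∃ v, R1 w v ∧ BSat R0 R1 val v φ

/-! ## Frames -/

/-- A (unimodal) frame: a nonempty set with a binary relation. -/
structure Frame : Type 1 where
  W : Type
  R : W → W → Prop
  ne : Nonempty W

/-- A 2-frame: a nonempty set with two binary relations. -/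
structure Frame2 : Type 1 where
  W : Type
  R0 : W → W → Prop
  R1 : W → W → Prop
  ne : Nonempty W

/-- Validity of a bimodal formula in a 2-frame. -/
def Frame2.Valid (F : Frame2) (φ : BForm) : Prop :=
  ∀ (val : ℕ → F.W → Prop) (w : F.W), BSat F.R0 F.R1 val w φ

/-- Satisfaction of a bimodal formula in some model based on the 2-frame. -/
def Frame2.Sat (F : Frame2) (φ : BForm) : Prop :=
  ∃ (val : ℕ → F.W → Prop) (w : F.W), BSat F.R0 F.R1 val w φ

/-- Horizontal relation of a product frame. -/
def prodR0 {A B : Type} (R : A → A → Prop) : A × B → A × B → Prop :=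
  fun p q => R p.1 q.1 ∧ p.2 = q.2

/-- Vertical relation of a product frame. -/
def prodR1 {A B : Type} (S : B → B → Prop) : A × B → A × B → Prop :=
  fun p q => p.1 = q.1 ∧ S p.2 q.2

/-- `φ` is satisfied in some model based on the product frame `⟨A,R⟩ × ⟨B,S⟩`. -/
def ProdSat {A B : Type} (R : A → A → Prop) (S : B → B → Prop) (φ : BForm) : Prop :=
  ∃ (val : ℕ → A × B → Prop) (w : A × B), BSat (prodR0 R) (prodR1 S) val w φ

/-- `φ` is valid in the product frame `⟨A,R⟩ × ⟨B,S⟩`. -/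
def ProdValid {A B : Type} (R : A → A → Prop) (S : B → B → Prop) (φ : BForm) : Prop :=
  ∀ (val : ℕ → A × B → Prop) (w : A × B), BSat (prodR0 R) (prodR1 S) val w φ

/-- The product 2-frame of two frames. -/
def prodFrame2 (A B : Type) [Nonempty A] [Nonempty B]
    (R : A → A → Prop) (S : B → B → Prop) : Frame2 :=
  ⟨A × B, prodR0 R, prodR1 S, inferInstance⟩

/-- Linear order: irreflexive, transitive and trichotomous. -/
def IsLin {T : Type} (R : T → T → Prop) : Prop :=
  (∀ x, ¬ R x x) ∧ (∀ x y z, R x y → R y z → R x z) ∧ (∀ x y, R x y ∨ x = y ∨ R y x)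

/-- Weak order: transitive and weakly connected. -/
def WeakOrd {T : Type} (R : T → T → Prop) : Prop :=
  (∀ x y z, R x y → R y z → R x z) ∧ (∀ x y z, R x y → R x z → y = z ∨ R y z ∨ R z y)

/-- Modal discreteness. -/
def ModallyDiscrete {T : Type} (R : T → T → Prop) : Prop :=
  ¬ ∃ (x : ℕ → T) (xω : T), (∀ i, R (x i) (x (i+1))) ∧ (∀ i, x i ≠ x (i+1)) ∧
      (∀ i, R (x i) xω) ∧ (∀ i, ¬ R xω (x i))

/-- No infinite ascending chains of distinct points. -/
def Noetherian {T : Type} (R : T → T → Prop) : Prop :=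
  ¬ ∃ x : ℕ → T, (∀ i, R (x i) (x (i+1))) ∧ (∀ i, x i ≠ x (i+1))

/-- The frame is (isomorphic to) `⟨ω,<⟩`. -/
def IsOmegaFrame (F : Frame) : Prop :=
  ∃ e : F.W ≃ ℕ, ∀ a b, F.R a b ↔ e a < e b

/-- The frame is a finite linear order. -/
def IsFinLinFrame (F : Frame) : Prop := Finite F.W ∧ IsLin F.R

/-- `F` contains an `⟨ω+1,>⟩`-type chain: distinct points `x₀,…,x_n,…,x_ω` with
`x_n R x_m` iff `n > m` (for `n ≠ m`). -/
def HasOmegaPlusOneChain (F : Frame) : Prop :=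
  ∃ (x : ℕ → F.W) (xω : F.W), Function.Injective x ∧ (∀ n, x n ≠ xω) ∧
    (∀ n m, n ≠ m → (F.R (x n) (x m) ↔ m < n)) ∧
    (∀ n, F.R xω (x n)) ∧ (∀ n, ¬ F.R (x n) xω)

/-! ## Two-dimensional (expanding/decreasing) 2-frames `H_{F,Ḡ}` -/

/-- A 2-frame `H_{F,Ḡ}` built from a horizontal frame `⟨H,R⟩` and, for each `x : H`,
a vertical frame `G_x = ⟨D x, S x⟩` carved out of a common ambient type `V`. -/
structure TwoFrame : Type 1 where
  H : Type
  R : H → H → Prop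
  Hne : Nonempty H
  V : Type
  D : H → Set V
  S : H → V → V → Prop
  Dne : ∀ x, (D x).Nonempty

namespace TwoFrame

/-- The horizontal frame. -/
def horiz (T : TwoFrame) : Frame := ⟨T.H, T.R, T.Hne⟩

/-- The vertical frame `G_x` at `x`. -/
def fiber (T : TwoFrame) (x : T.H) : Frame :=
  ⟨{a : T.V // a ∈ T.D x}, fun a b => T.S x a.1 b.1,
    Exists.elim (T.Dne x) (fun a ha => ⟨⟨a, ha⟩⟩)⟩

/-- The worlds `{⟨u,v⟩ : u ∈ H, v ∈ D u}`. -/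
def Worlds (T : TwoFrame) : Type := {p : T.H × T.V // p.2 ∈ T.D p.1}

/-- Horizontal relation of `H_{F,Ḡ}`. -/
def Rh (T : TwoFrame) : T.Worlds → T.Worlds → Prop :=
  fun p q => T.R p.1.1 q.1.1 ∧ p.1.2 = q.1.2

/-- Vertical relation of `H_{F,Ḡ}`. -/
def Rv (T : TwoFrame) : T.Worlds → T.Worlds → Prop :=
  fun p q => p.1.1 = q.1.1 ∧ T.S p.1.1 p.1.2 q.1.2

/-- `φ` is satisfied in some model based on `H_{F,Ḡ}`. -/
def Sat (T : TwoFrame) (φ : BForm) : Prop :=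
  ∃ (val : ℕ → T.Worlds → Prop) (w : T.Worlds), BSat T.Rh T.Rv val w φ

/-- Decreasing 2-frame: `G_y` is a subframe of `G_x` whenever `x R y`. -/
def Decreasing (T : TwoFrame) : Prop :=
  ∀ x y, T.R x y → T.D y ⊆ T.D x ∧ ∀ a ∈ T.D y, ∀ b ∈ T.D y, (T.S y a b ↔ T.S x a b)

/-- Expanding 2-frame: `G_x` is a subframe of `G_y` whenever `x R y`. -/
def Expanding (T : TwoFrame) : Prop :=
  ∀ x y, T.R x y → T.D x ⊆ T.D y ∧ ∀ a ∈ T.D x, ∀ b ∈ T.D x, (T.S x a b ↔ T.S y a b)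

/-- All vertical frames are difference frames. -/
def DiffFibers (T : TwoFrame) : Prop :=
  ∀ x, ∀ a ∈ T.D x, ∀ b ∈ T.D x, (T.S x a b ↔ a ≠ b)

end TwoFrame

/-- `φ` is satisfied in some model based on a product of a member of `C`
with a difference frame. -/
def ProdDiffSat (C : Frame → Prop) (φ : BForm) : Prop :=
  ∃ F : Frame, C F ∧ ∃ D : Type, Nonempty D ∧ ProdSat F.R (fun a b : D => a ≠ b) φ

/-- `φ` is satisfied in some model based on a decreasing 2-frame with horizontal
frame in `C` and all vertical frames difference frames. -/
def DecDiffSat (C : Frame → Prop) (φ : BForm) : Prop :=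
  ∃ T : TwoFrame, C T.horiz ∧ T.Decreasing ∧ T.DiffFibers ∧ T.Sat φ

/-- `φ` is satisfied in some model based on an expanding 2-frame with horizontal
frame in `C` and all vertical frames difference frames. -/
def ExpDiffSat (C : Frame → Prop) (φ : BForm) : Prop :=
  ∃ T : TwoFrame, C T.horiz ∧ T.Expanding ∧ T.DiffFibers ∧ T.Sat φ

/-- `φ` is satisfied in some model based on a product of a member of `C0` with a
member of `C1`. -/
def ProdClassSat (C0 C1 : Frame → Prop) (φ : BForm) : Prop :=
  ∃ F0, C0 F0 ∧ ∃ F1, C1 F1 ∧ ProdSat F0.R F1.R φ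

/-- `φ` is satisfied in some model based on a decreasing 2-frame with horizontal
frame in `C0` and all vertical frames in `C1`. -/
def DecClassSat (C0 C1 : Frame → Prop) (φ : BForm) : Prop :=
  ∃ T : TwoFrame, C0 T.horiz ∧ (∀ x, C1 (T.fiber x)) ∧ T.Decreasing ∧ T.Sat φ

/-- `φ` is satisfied in some model based on an expanding 2-frame with horizontal
frame in `C0` and all vertical frames in `C1`. -/
def ExpClassSat (C0 C1 : Frame → Prop) (φ : BForm) : Prop :=
  ∃ T : TwoFrame, C0 T.horiz ∧ (∀ x, C1 (T.fiber x)) ∧ T.Expanding ∧ T.Sat φ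

/-- Satisfiability over products of `⟨ω,<⟩` with difference frames. -/
def OmegaDiffSat (φ : BForm) : Prop :=
  ∃ D : Type, Nonempty D ∧ ProdSat (fun m n : ℕ => m < n) (fun a b : D => a ≠ b) φ

/-- Satisfiability over products of finite linear orders with difference frames. -/
def FinLinDiffSat (φ : BForm) : Prop :=
  ∃ (T : Type) (R : T → T → Prop), Finite T ∧ IsLin R ∧
    ∃ D : Type, Nonempty D ∧ ProdSat R (fun a b : D => a ≠ b) φ

/-! ## Bimodal logics -/

/-- Propositional tautology (diamond formulas treated as atoms). -/
def IsTaut (φ : BForm) : Prop :=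
  ∀ v : BForm → Prop, (∀ ψ, v (BForm.neg ψ) ↔ ¬ v ψ) →
    (∀ ψ χ, v (BForm.and ψ χ) ↔ v ψ ∧ v χ) → v φ

/-- Normal bimodal logic. -/
structure IsLogic (L : Set BForm) : Prop where
  taut : ∀ φ, IsTaut φ → φ ∈ L
  K0 : BForm.imp (BForm.box0 (BForm.imp (BForm.var 0) (BForm.var 1)))
        (BForm.imp (BForm.box0 (BForm.var 0)) (BForm.box0 (BForm.var 1))) ∈ L
  K1 : BForm.imp (BForm.box1 (BForm.imp (BForm.var 0) (BForm.var 1)))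
        (BForm.imp (BForm.box1 (BForm.var 0)) (BForm.box1 (BForm.var 1))) ∈ L
  mp : ∀ φ ψ, BForm.imp φ ψ ∈ L → φ ∈ L → ψ ∈ L
  subst : ∀ φ s, φ ∈ L → BForm.subst s φ ∈ L
  nec0 : ∀ φ, φ ∈ L → BForm.box0 φ ∈ L
  nec1 : ∀ φ, φ ∈ L → BForm.box1 φ ∈ L

/-- Validity of a (◇₀-)formula in a unimodal frame `⟨W,R⟩`. -/
def UValid0 {W : Type} (R : W → W → Prop) (φ : BForm) : Prop :=
  ∀ (val : ℕ → W → Prop) (w : W), BSat R (fun _ _ => False) val w φ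

/-- Validity of a (◇₁-)formula in a unimodal frame `⟨W,S⟩`. -/
def UValid1 {W : Type} (S : W → W → Prop) (φ : BForm) : Prop :=
  ∀ (val : ℕ → W → Prop) (w : W), BSat (fun _ _ => False) S val w φ

/-- `K4.3`: the unimodal logic (in `◇₀`) of all linear orders. -/
def K43 : Set BForm :=
  {φ | φ.OnlyDia0 ∧ ∀ (T : Type) (R : T → T → Prop), Nonempty T → IsLin R → UValid0 R φ}

/-- `Diff`: the unimodal logic (in `◇₁`) of all difference frames. -/
def DiffLogic : Set BForm :=
  {φ | φ.OnlyDia1 ∧ ∀ (D : Type), Nonempty D → UValid1 (fun a b : D => a ≠ b) φ}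

/-- `Log⟨ω,<⟩`: the unimodal logic (in `◇₀`) of the frame `⟨ω,<⟩`. -/
def LogOmega : Set BForm :=
  {φ | φ.OnlyDia0 ∧ UValid0 (fun m n : ℕ => m < n) φ}

/-- `GL.3`: the unimodal logic (in `◇₀`) of all Noetherian irreflexive linear orders. -/
def GL3 : Set BForm :=
  {φ | φ.OnlyDia0 ∧
    ∀ (T : Type) (R : T → T → Prop), Nonempty T → IsLin R → Noetherian R → UValid0 R φ}

/-- `DisK4.3`: the unimodal logic (in `◇₀`) of all modally discrete weak orders. -/
def DisK43 : Set BForm :=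
  {φ | φ.OnlyDia0 ∧
    ∀ (T : Type) (R : T → T → Prop), Nonempty T → WeakOrd R → ModallyDiscrete R → UValid0 R φ}

def commAx1 : BForm :=
  BForm.imp (BForm.box1 (BForm.box0 (BForm.var 0))) (BForm.box0 (BForm.box1 (BForm.var 0)))
def commAx2 : BForm :=
  BForm.imp (BForm.box0 (BForm.box1 (BForm.var 0))) (BForm.box1 (BForm.box0 (BForm.var 0)))
def commAx3 : BForm :=
  BForm.imp (BForm.dia0 (BForm.box1 (BForm.var 0))) (BForm.box1 (BForm.dia0 (BForm.var 0)))

/-- The commutator `[L0,L1]`: the smallest bimodal logic containing `L0`, `L1` (and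
hence their fusion) together with the commutativity/confluence axioms. -/
def Commutator (L0 L1 : Set BForm) : Set BForm :=
  ⋂₀ {L : Set BForm | IsLogic L ∧ L0 ⊆ L ∧ L1 ⊆ L ∧
      commAx1 ∈ L ∧ commAx2 ∈ L ∧ commAx3 ∈ L}

/-- The product logic `L0 × L1`: the logic of all products of a frame for `L0`
with a frame for `L1`. -/
def ProdLogic (L0 L1 : Set BForm) : Set BForm :=
  {φ | ∀ (A B : Type), Nonempty A → Nonempty B → ∀ (R : A → A → Prop) (S : B → B → Prop),
      (∀ ψ ∈ L0, UValid0 R ψ) → (∀ ψ ∈ L1, UValid1 S ψ) → ProdValid R S φ}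

/-- The logic of a class of 2-frames. -/
def LogOf (C : Frame2 → Prop) : Set BForm := {φ | ∀ F, C F → F.Valid φ}

/-- Kripke completeness of a bimodal logic. -/
def KripkeComplete (L : Set BForm) : Prop := ∃ C : Frame2 → Prop, L = LogOf C

/-- `L`-satisfiability: `φ` is satisfied in some model `M` with `M ⊨ L`. -/
def LSat (L : Set BForm) (φ : BForm) : Prop :=
  ∃ (W : Type) (_ : Nonempty W) (R0 R1 : W → W → Prop) (val : ℕ → W → Prop),
    (∀ ψ ∈ L, ∀ w, BSat R0 R1 val w ψ) ∧ ∃ w, BSat R0 R1 val w φ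

/-! ## One-variable first-order temporal logic with counting (FOLTL≠) -/

/-- FOLTL≠-formulas: `φ ::= P(x) | ¬φ | φ∧ψ | ◇_F φ | ∃≠x φ`. -/
inductive TForm : Type
  | atom : ℕ → TForm
  | neg : TForm → TForm
  | and : TForm → TForm → TForm
  | diaF : TForm → TForm
  | exNe : TForm → TForm

/-- Truth of an FOLTL≠-formula in a first-order temporal model based on the
timeline `⟨T,lt⟩` with domains `D` and interpretation `I`. -/
def TSat {T U : Type} (lt : T → T → Prop) (D : T → Set U) (I : ℕ → T → U → Prop) :
    T → U → TForm → Prop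
  | t, a, .atom n => I n t a
  | t, a, .neg φ => ¬ TSat lt D I t a φ
  | t, a, .and φ ψ => TSat lt D I t a φ ∧ TSat lt D I t a ψ
  | t, a, .diaF φ => ∃ t', lt t t' ∧ a ∈ D t' ∧ TSat lt D I t' a φ
  | t, a, .exNe φ => ∃ b, b ∈ D t ∧ b ≠ a ∧ TSat lt D I t b φ

/-- The standard translation `⋆` from FOLTL≠-formulas to bimodal formulas. -/
def TForm.star : TForm → BForm
  | .atom n => .var n
  | .neg φ => .neg (TForm.star φ)
  | .and φ ψ => .and (TForm.star φ) (TForm.star ψ)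
  | .diaF φ => .dia0 (TForm.star φ)
  | .exNe φ => .dia1 (TForm.star φ)

/-- Satisfiability in constant domain models over the timeline `⟨T,lt⟩`. -/
def FOLTLConstSat {T : Type} (lt : T → T → Prop) (φ : TForm) : Prop :=
  ∃ (U : Type) (I : ℕ → T → U → Prop) (t : T) (a : U),
    TSat lt (fun _ => (Set.univ : Set U)) I t a φ

/-- Satisfiability in decreasing domain models over the timeline `⟨T,lt⟩`. -/
def FOLTLDecSat {T : Type} (lt : T → T → Prop) (φ : TForm) : Prop :=
  ∃ (U : Type) (D : T → Set U), (∀ t, (D t).Nonempty) ∧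
    (∀ t t', lt t t' → D t' ⊆ D t) ∧
    ∃ (I : ℕ → T → U → Prop) (t : T) (a : U), a ∈ D t ∧ TSat lt D I t a φ

/-- Satisfiability in expanding domain models over the timeline `⟨T,lt⟩`. -/
def FOLTLExpSat {T : Type} (lt : T → T → Prop) (φ : TForm) : Prop :=
  ∃ (U : Type) (D : T → Set U), (∀ t, (D t).Nonempty) ∧
    (∀ t t', lt t t' → D t ⊆ D t') ∧
    ∃ (I : ℕ → T → U → Prop) (t : T) (a : U), a ∈ D t ∧ TSat lt D I t a φ

/-- Satisfiability in constant domain models over a class `C` of timelines. -/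
def FOLTLConstSatC (C : Frame → Prop) (φ : TForm) : Prop :=
  ∃ F, C F ∧ FOLTLConstSat F.R φ

/-- Satisfiability in decreasing domain models over a class `C` of timelines. -/
def FOLTLDecSatC (C : Frame → Prop) (φ : TForm) : Prop :=
  ∃ F, C F ∧ FOLTLDecSat F.R φ

/-- Satisfiability in expanding domain models over a class `C` of timelines. -/
def FOLTLExpSatC (C : Frame → Prop) (φ : TForm) : Prop :=
  ∃ F, C F ∧ FOLTLExpSat F.R φ

/-- The class of all linear orders. -/
def AllLin : Frame → Prop := fun F => IsLin F.R

/-- The class of all finite linear orders. -/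
def AllFinLin : Frame → Prop := IsFinLinFrame

/-! ## Gödel numbering -/

/-- A fixed effective Gödel numbering of bimodal formulas. -/
def encodeB : BForm → ℕ
  | .var n => Nat.pair 0 n
  | .neg φ => Nat.pair 1 (encodeB φ)
  | .and φ ψ => Nat.pair 2 (Nat.pair (encodeB φ) (encodeB ψ))
  | .dia0 φ => Nat.pair 3 (encodeB φ)
  | .dia1 φ => Nat.pair 4 (encodeB φ)

/-- A fixed effective Gödel numbering of FOLTL≠-formulas. -/
def encodeT : TForm → ℕ
  | .atom n => Nat.pair 0 n
  | .neg φ => Nat.pair 1 (encodeT φ)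
  | .and φ ψ => Nat.pair 2 (Nat.pair (encodeT φ) (encodeT ψ))
  | .diaF φ => Nat.pair 3 (encodeT φ)
  | .exNe φ => Nat.pair 4 (encodeT φ)

/-- The set of codes of bimodal formulas with property `P`. -/
def BCodes (P : BForm → Prop) : ℕ → Prop := fun n => ∃ φ, encodeB φ = n ∧ P φ

/-- The set of codes of FOLTL≠-formulas with property `P`. -/
def TCodes (P : TForm → Prop) : ℕ → Prop := fun n => ∃ φ, encodeT φ = n ∧ P φ

/-! ## The analytical hierarchy: Σ₁¹ -/

/-- `A ⊆ ℕ` is `Σ₁¹`: in normal form `n ∈ A ↔ ∃ f : ℕ → ℕ, ∀ m, R (n, f̄(m))`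
for a computable predicate `R` of the number `n` and finite initial segments of `f`. -/
def Sigma11 (A : ℕ → Prop) : Prop :=
  ∃ R : ℕ × List ℕ → Prop, ComputablePred R ∧
    ∀ n, A n ↔ ∃ f : ℕ → ℕ, ∀ m, R (n, (List.range m).map f)

/-- `Σ₁¹`-hardness with respect to computable many-one reducibility. -/
def Sigma11Hard (A : ℕ → Prop) : Prop := ∀ B : ℕ → Prop, Sigma11 B → ManyOneReducible B A

/-- `Σ₁¹`-completeness. -/
def Sigma11Complete (A : ℕ → Prop) : Prop := Sigma11 A ∧ Sigma11Hard A

/-! ## Counter (Minsky) machines -/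

/-- Counter machine operations: `inl i` increments counter `i`, `inr (inl i)`
decrements counter `i`, `inr (inr i)` zero-tests counter `i`. -/
abbrev CMOp : Type := ℕ ⊕ ℕ ⊕ ℕ

def CMOp.counter : CMOp → ℕ
  | Sum.inl i => i
  | Sum.inr (Sum.inl i) => i
  | Sum.inr (Sum.inr i) => i

/-- Description of a counter machine: number `N` of counters, number of states
(states are `0,…,states-1`), list of terminal states, and list of instructions
`(q, op, q')`. -/
abbrev CMDesc : Type := ℕ × ℕ × List ℕ × List (ℕ × CMOp × ℕ)

/-- Well-formedness of a counter machine description: `N > 1`, terminal states are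
states, instructions are attached to non-terminal states and mention genuine
counters, and every non-terminal state has at least one instruction. -/
def CMWF (M : CMDesc) : Prop :=
  1 < M.1 ∧ (∀ q ∈ M.2.2.1, q < M.2.1) ∧
  (∀ t ∈ M.2.2.2, t.1 < M.2.1 ∧ t.1 ∉ M.2.2.1 ∧ t.2.2 < M.2.1 ∧ CMOp.counter t.2.1 < M.1) ∧
  (∀ q, q < M.2.1 → q ∉ M.2.2.1 → ∃ t ∈ M.2.2.2, t.1 = q)

/-- A configuration: current state and contents of the counters. -/
abbrev CMConfig : Type := ℕ × (ℕ → ℕ)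

/-- Reliable step of a counter machine. -/
def CMStep (M : CMDesc) (σ σ' : CMConfig) : Prop :=
  ∃ op q', (σ.1, op, q') ∈ M.2.2.2 ∧ σ'.1 = q' ∧
    match op with
    | Sum.inl i => σ'.2 i = σ.2 i + 1 ∧ ∀ j, j ≠ i → σ'.2 j = σ.2 j
    | Sum.inr (Sum.inl i) => 0 < σ.2 i ∧ σ'.2 i + 1 = σ.2 i ∧ ∀ j, j ≠ i → σ'.2 j = σ.2 j
    | Sum.inr (Sum.inr i) => σ.2 i = 0 ∧ ∀ j, σ'.2 j = σ.2 j

/-- Lossy step of a counter machine. -/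
def CMStepLossy (M : CMDesc) (σ σ' : CMConfig) : Prop :=
  ∃ c1 c2 : ℕ → ℕ, CMStep M (σ.1, c1) (σ'.1, c2) ∧ (∀ i, c1 i ≤ σ.2 i) ∧ (∀ i, σ'.2 i ≤ c2 i)

/-- The configuration `⟨q, 𝟎⟩` with all-0 counters. -/
def zeroConfig (q : ℕ) : CMConfig := (q, fun _ => 0)

/-- CM non-termination: the machine has an infinite run starting with `⟨q₀,𝟎⟩`. -/
def CMNonTerm : CMDesc × ℕ → Prop := fun p =>
  CMWF p.1 ∧ ∃ ρ : ℕ → CMConfig, ρ 0 = zeroConfig p.2 ∧ ∀ n, CMStep p.1 (ρ n) (ρ (n+1))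

/-- CM reachability: the machine has a run starting with `⟨q₀,𝟎⟩` reaching `q_r`. -/
def CMReach : CMDesc × ℕ × ℕ → Prop := fun p =>
  CMWF p.1 ∧ ∃ (B : ℕ) (ρ : ℕ → CMConfig), ρ 0 = zeroConfig p.2.1 ∧
    (∀ n, n < B → CMStep p.1 (ρ n) (ρ (n+1))) ∧ (ρ B).1 = p.2.2

/-- CM recurrence: the machine has an infinite run starting with `⟨q₀,𝟎⟩`
visiting `q_r` infinitely often. -/
def CMRecur : CMDesc × ℕ × ℕ → Prop := fun p =>
  CMWF p.1 ∧ ∃ ρ : ℕ → CMConfig, ρ 0 = zeroConfig p.2.1 ∧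
    (∀ n, CMStep p.1 (ρ n) (ρ (n+1))) ∧ ∀ n, ∃ m, n ≤ m ∧ (ρ m).1 = p.2.2

/-- LCM reachability: the machine has a lossy run starting with `⟨q₀,𝟎⟩`
reaching `q_r`. -/
def LCMReach : CMDesc × ℕ × ℕ → Prop := fun p =>
  CMWF p.1 ∧ ∃ (B : ℕ) (ρ : ℕ → CMConfig), ρ 0 = zeroConfig p.2.1 ∧
    (∀ n, n < B → CMStepLossy p.1 (ρ n) (ρ (n+1))) ∧ (ρ B).1 = p.2.2

/-- LCM ω-reachability: for every `k`, the machine has a lossy run starting with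
`⟨q₀,𝟎⟩` visiting `q_r` at least `k` times. -/
def LCMOmegaReach : CMDesc × ℕ × ℕ → Prop := fun p =>
  CMWF p.1 ∧ ∀ k : ℕ, ∃ (B : ℕ) (ρ : ℕ → CMConfig), ρ 0 = zeroConfig p.2.1 ∧
    (∀ n, n < B → CMStepLossy p.1 (ρ n) (ρ (n+1))) ∧
    k ≤ ((Finset.range (B+1)).filter (fun n => (ρ n).1 = p.2.2)).card

/-! ## Particular formulas used in the statements -/

/-- `□₁⁺□₀⁺(◇₀⊤ → □₁◇₀⊤) ∧ φ` (Prop. 2.4 of the paper). -/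
def diffDecForm (φ : BForm) : BForm :=
  BForm.and
    (BForm.boxP1 (BForm.boxP0
      (BForm.imp (BForm.dia0 BForm.top) (BForm.box1 (BForm.dia0 BForm.top))))) φ

/-- `D ∧ □₀^{≤n}□₁^{≤n}(◇₀D → D) ∧ φ^D`. -/
def decRelForm (d n : ℕ) (φ : BForm) : BForm :=
  BForm.and (BForm.var d)
    (BForm.and
      (BForm.boxLe0 n (BForm.boxLe1 n
        (BForm.imp (BForm.dia0 (BForm.var d)) (BForm.var d))))
      (BForm.relativize d φ))

/-- `D ∧ □₀^{≤n}□₁^{≤n}(D → □₀D) ∧ φ^D`. -/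
def expRelForm (d n : ℕ) (φ : BForm) : BForm :=
  BForm.and (BForm.var d)
    (BForm.and
      (BForm.boxLe0 n (BForm.boxLe1 n
        (BForm.imp (BForm.var d) (BForm.box0 (BForm.var d)))))
      (BForm.relativize d φ))

section
open BForm

/-! ## Part A: the reduction formula and its semantics -/

def orF (φ ψ : BForm) : BForm := neg (and (neg φ) (neg ψ))
def diaP1 (φ : BForm) : BForm := orF φ (dia1 φ)
def noF (φ : BForm) : BForm := neg (diaP1 φ)
def ex1F (φ : BForm) : BForm := diaP1 (and φ (neg (dia1 φ)))
/-- none of the literals `3 * j + a`, `j<k`. -/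
def nolit (a : ℕ) : ℕ → BForm
  | 0 => top
  | k+1 => and (nolit a k) (neg (var (3*k+a)))
def excl (a k : ℕ) : BForm := and (nolit a k) (var (3*k+a))
def opc : CMOp → ℕ
  | Sum.inl i => 3*i
  | Sum.inr (Sum.inl i) => 3*i+1
  | Sum.inr (Sum.inr i) => 3*i+2
def pF (i : ℕ) : BForm := var (3*i+3)
def inF (i : ℕ) : BForm :=
  and (neg (pF i)) (and (dia0 (pF i)) (neg (dia0 (and (neg (pF i)) (dia0 (pF i))))))
def outF (i : ℕ) : BForm := and (pF i) (neg (dia0 (pF i)))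
def convF (i : ℕ) : BForm :=
  noF (and (pF i) (dia0 (and (neg (pF i)) (dia0 (pF i)))))
def clauseF (i : ℕ) : BForm :=
  and (imp (excl 2 (3*i)) (ex1F (inF i)))
  (and (orF (excl 2 (3*i)) (noF (inF i)))
  (and (imp (excl 2 (3*i+1)) (ex1F (outF i)))
  (and (orF (excl 2 (3*i+1)) (noF (outF i)))
  (and (imp (excl 2 (3*i+2)) (noF (pF i))) (convF i)))))
def nextF (q : ℕ) : BForm :=
  diaP1 (and (neg (dia0 (dia0 (var 0)))) (dia0 (and (var 0) (noF (neg (excl 1 q))))))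
def trF (τ : ℕ × CMOp × ℕ) : BForm :=
  and (excl 1 τ.1) (and (excl 2 (opc τ.2.1)) (nextF τ.2.2))
def ctrF (i : ℕ) : BForm := and (noF (pF i)) (boxP0 (clauseF i))
def allF (L : List (ℕ × CMOp × ℕ)) : BForm :=
  L.foldr (fun τ acc => and (ctrF (CMOp.counter τ.2.1)) acc) top
def someF (L : List (ℕ × CMOp × ℕ)) : BForm :=
  L.foldr (fun τ acc => orF (trF τ) acc) bot
def redF (p : CMDesc × ℕ × ℕ) : BForm :=
  and (excl 1 p.2.1) (and (allF p.1.2.2.2)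
    (and (boxP0 (someF p.1.2.2.2)) (boxP0 (dia0 (excl 1 p.2.2)))))

section sem
variable {D : Type} (val : ℕ → ℕ × D → Prop)

/-- truth at `(t,d)` in the product model -/
def PS (t : ℕ) (d : D) (φ : BForm) : Prop :=
  BSat (prodR0 (fun m n : ℕ => m < n)) (prodR1 (fun a b : D => a ≠ b)) val (t, d) φ

variable (t : ℕ) (d : D)
theorem PS_var (n) : PS val t d (var n) ↔ val n (t,d) := Iff.rfl
theorem PS_neg (φ) : PS val t d (neg φ) ↔ ¬ PS val t d φ := Iff.rfl
theorem PS_and (φ ψ) : PS val t d (and φ ψ) ↔ PS val t d φ ∧ PS val t d ψ := Iff.rfl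
theorem PS_dia0 (φ) : PS val t d (dia0 φ) ↔ ∃ u, t < u ∧ PS val u d φ := by
  constructor
  · rintro ⟨⟨u, e⟩, ⟨h1, h2⟩, h⟩
    simp only at h1 h2
    subst h2
    exact ⟨u, h1, h⟩
  · rintro ⟨u, h1, h⟩
    exact ⟨(u, d), ⟨h1, rfl⟩, h⟩
theorem PS_dia1 (φ) : PS val t d (dia1 φ) ↔ ∃ e, d ≠ e ∧ PS val t e φ := by
  constructor
  · rintro ⟨⟨u, e⟩, ⟨h1, h2⟩, h⟩
    simp only at h1 h2
    subst h1
    exact ⟨e, h2, h⟩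
  · rintro ⟨e, h1, h⟩
    exact ⟨(t, e), ⟨rfl, h1⟩, h⟩
theorem PS_imp (φ ψ) : PS val t d (imp φ ψ) ↔ (PS val t d φ → PS val t d ψ) := by
  simp only [imp, PS_neg, PS_and]; tauto
theorem PS_or (φ ψ) : PS val t d (orF φ ψ) ↔ (PS val t d φ ∨ PS val t d ψ) := by
  simp only [orF, PS_neg, PS_and]; tauto
theorem PS_bot : ¬ PS val t d bot := by
  simp only [bot, PS_neg, PS_and]; tauto
theorem PS_top : PS val t d top := PS_bot val t d
theorem PS_boxP0 (φ) : PS val t d (boxP0 φ) ↔ ∀ u, t ≤ u → PS val u d φ := by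
  simp only [boxP0, box0, PS_neg, PS_and, PS_dia0]
  constructor
  · rintro ⟨h1, h2⟩ u hu
    rcases hu.eq_or_lt with rfl | hu
    · exact h1
    · by_contra h; exact h2 ⟨u, hu, h⟩
  · intro h
    refine ⟨h t le_rfl, ?_⟩
    rintro ⟨u, hu, h'⟩
    exact h' (h u hu.le)
theorem PS_diaP1 (φ) : PS val t d (diaP1 φ) ↔ ∃ e, PS val t e φ := by
  simp only [diaP1, PS_or, PS_dia1]
  constructor
  · rintro (h | ⟨e, -, h⟩)
    · exact ⟨d, h⟩
    · exact ⟨e, h⟩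
  · rintro ⟨e, h⟩
    by_cases hde : d = e
    · subst hde; exact Or.inl h
    · exact Or.inr ⟨e, hde, h⟩
theorem PS_noF (φ) : PS val t d (noF φ) ↔ ∀ e, ¬ PS val t e φ := by
  simp only [noF, PS_neg, PS_diaP1]; push Not; rfl
theorem PS_ex1F (φ) : PS val t d (ex1F φ) ↔ ∃ e, ∀ e', PS val t e' φ ↔ e' = e := by
  simp only [ex1F, PS_neg, PS_diaP1, PS_and, PS_dia1]
  constructor
  · rintro ⟨e, h1, h2⟩
    refine ⟨e, fun e' => ⟨fun h => ?_, ?_⟩⟩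
    · by_contra hne
      exact h2 ⟨e', fun h' => hne h'.symm, h⟩
    · rintro rfl; exact h1
  · rintro ⟨e, h⟩
    refine ⟨e, (h e).2 rfl, ?_⟩
    rintro ⟨e', hne, h'⟩
    exact hne ((h e').1 h').symm
theorem PS_nolit (a k) : PS val t d (nolit a k) ↔ ∀ j < k, ¬ val (3*j+a) (t,d) := by
  induction k with
  | zero => simp [nolit, PS_top]
  | succ k ih =>
    simp only [nolit, PS_and, PS_neg, PS_var, ih]
    constructor
    · rintro ⟨h1, h2⟩ j hj
      rcases Nat.lt_succ_iff_lt_or_eq.1 hj with h | rfl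
      · exact h1 j h
      · exact h2
    · intro h
      exact ⟨fun j hj => h j (by omega), h k (by omega)⟩
theorem PS_excl (a k) : PS val t d (excl a k) ↔
    (∀ j < k, ¬ val (3*j+a) (t,d)) ∧ val (3*k+a) (t,d) := by
  simp only [excl, PS_and, PS_nolit, PS_var]
theorem excl_inj {a k l} (h1 : PS val t d (excl a k)) (h2 : PS val t d (excl a l)) : k = l := by
  rw [PS_excl] at h1 h2
  rcases lt_trichotomy k l with h | h | h
  · exact absurd h1.2 (h2.1 _ h)
  · exact h
  · exact absurd h2.2 (h1.1 _ h)
theorem PS_allF (L) : PS val t d (allF L) ↔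
    ∀ τ ∈ L, PS val t d (ctrF (CMOp.counter τ.2.1)) := by
  induction L with
  | nil => simp [allF, PS_top]
  | cons a L ih =>
    have : allF (a :: L) = and (ctrF (CMOp.counter a.2.1)) (allF L) := rfl
    rw [this, PS_and, ih]; simp
theorem PS_someF (L) : PS val t d (someF L) ↔ ∃ τ ∈ L, PS val t d (trF τ) := by
  induction L with
  | nil => simp [someF, PS_bot]
  | cons a L ih =>
    have : someF (a :: L) = orF (trF a) (someF L) := rfl
    rw [this, PS_or, ih]; simp
theorem PS_nextF (q) : PS val t d (nextF q) ↔
    ∃ e, val 0 (t+1, e) ∧ (∀ u, t + 1 < u → ¬ val 0 (u, e)) ∧ ∀ e', PS val (t+1) e' (excl 1 q) := by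
  simp only [nextF, PS_diaP1, PS_and, PS_neg, PS_dia0, PS_noF, not_not, PS_var]
  constructor
  · rintro ⟨e, h1, u, hu, h2, h3⟩
    have : u = t + 1 := by
      by_contra hne
      exact h1 ⟨t+1, by omega, u, by omega, h2⟩
    subst this
    exact ⟨e, h2, fun v hv h => h1 ⟨t+1, by omega, v, hv, h⟩, h3⟩
  · rintro ⟨e, h1, h2, h3⟩
    exact ⟨e, fun ⟨u, hu, v, hv, h⟩ => h2 v (by omega) h, t+1, by omega, h1, h3⟩

/-- convexity of a row from `t` on -/
def Conv (p : ℕ → Prop) (t0 : ℕ) : Prop := ∀ t u v, t0 ≤ t → t < u → u < v → p t → p v → p u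

theorem PS_inF (t0 i) (ht : t0 ≤ t) (hc : Conv (fun u => val (3*i+3) (u,d)) t0) :
    PS val t d (inF i) ↔ ¬ val (3*i+3) (t,d) ∧ val (3*i+3) (t+1,d) := by
  simp only [inF, pF, PS_and, PS_neg, PS_dia0, PS_var]
  constructor
  · rintro ⟨h1, ⟨u, hu, h2⟩, h3⟩
    refine ⟨h1, ?_⟩
    by_contra h
    have : t + 1 ≠ u := fun h' => h (h' ▸ h2)
    exact h3 ⟨t+1, by omega, h, u, by omega, h2⟩
  · rintro ⟨h1, h2⟩
    refine ⟨h1, ⟨t+1, by omega, h2⟩, ?_⟩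
    rintro ⟨u, hu, h3, v, hv, h4⟩
    have : t + 1 ≠ u := fun h' => h3 (h' ▸ h2)
    exact h3 (hc (t+1) u v (by omega) (by omega) hv h2 h4)
theorem PS_outF (t0 i) (ht : t0 ≤ t) (hc : Conv (fun u => val (3*i+3) (u,d)) t0) :
    PS val t d (outF i) ↔ val (3*i+3) (t,d) ∧ ¬ val (3*i+3) (t+1,d) := by
  simp only [outF, pF, PS_and, PS_neg, PS_dia0, PS_var]
  constructor
  · rintro ⟨h1, h2⟩
    exact ⟨h1, fun h => h2 ⟨t+1, by omega, h⟩⟩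
  · rintro ⟨h1, h2⟩
    refine ⟨h1, ?_⟩
    rintro ⟨u, hu, h3⟩
    have : t + 1 ≠ u := fun h' => h2 (h' ▸ h3)
    exact h2 (hc t (t+1) u ht (by omega) (by omega) h1 h3)
theorem PS_convF (i) : (∀ u, t ≤ u → PS val u d (convF i)) ↔
    ∀ e, Conv (fun u => val (3*i+3) (u,e)) t := by
  simp only [convF, pF, PS_noF, PS_and, PS_neg, PS_dia0, PS_var]
  constructor
  · intro h e a u v ha hu hv h1 h2
    by_contra h3
    exact h a ha e ⟨h1, u, hu, h3, v, hv, h2⟩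
  · rintro h u hu e ⟨h1, v, hv, h2, w, hw, h3⟩
    exact h2 (h e u v w hu hv hw h1 h3)

/-- Semantics of the counter clause. -/
theorem PS_ctrF (i) : PS val t d (ctrF i) ↔
    (∀ e, ¬ val (3*i+3) (t,e)) ∧ (∀ e, Conv (fun u => val (3*i+3) (u,e)) t) ∧
    ∀ u, t ≤ u →
      (PS val u d (excl 2 (3*i)) → ∃ e, ∀ e',
        (¬ val (3*i+3) (u,e') ∧ val (3*i+3) (u+1,e')) ↔ e' = e) ∧
      (PS val u d (excl 2 (3*i)) ∨ ∀ e', ¬ (¬ val (3*i+3) (u,e') ∧ val (3*i+3) (u+1,e'))) ∧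
      (PS val u d (excl 2 (3*i+1)) → ∃ e, ∀ e',
        (val (3*i+3) (u,e') ∧ ¬ val (3*i+3) (u+1,e')) ↔ e' = e) ∧
      (PS val u d (excl 2 (3*i+1)) ∨ ∀ e', ¬ (val (3*i+3) (u,e') ∧ ¬ val (3*i+3) (u+1,e'))) ∧
      (PS val u d (excl 2 (3*i+2)) → ∀ e', ¬ val (3*i+3) (u,e')) := by
  simp only [ctrF, clauseF, PS_and, PS_noF, PS_boxP0]
  simp only [← and_assoc]
  rw [and_assoc]
  simp only [PS_imp, PS_or, PS_ex1F, PS_noF]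
  constructor
  · rintro ⟨h1, h2⟩
    have hc := (PS_convF val t d i).1 (fun u hu => (h2 u hu).2)
    refine ⟨h1, hc, fun u hu => ?_⟩
    have := (h2 u hu).1
    simpa only [PS_inF val u _ t i hu (hc _), PS_outF val u _ t i hu (hc _), pF, PS_var] using this
  · rintro ⟨h1, hc, h2⟩
    refine ⟨h1, fun u hu => ⟨?_, (PS_convF val t d i).2 hc u hu⟩⟩
    have := h2 u hu
    simpa only [PS_inF val u _ t i hu (hc _), PS_outF val u _ t i hu (hc _), pF, PS_var] using this
end sem
end

section
open BForm

theorem opc_inc (op : CMOp) (i : ℕ) : opc op = 3*i ↔ op = Sum.inl i := by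
  rcases op with j | j | j <;> simp [opc] <;> omega
theorem opc_dec (op : CMOp) (i : ℕ) : opc op = 3*i+1 ↔ op = Sum.inr (Sum.inl i) := by
  rcases op with j | j | j <;> simp [opc] <;> omega
theorem opc_zero (op : CMOp) (i : ℕ) : opc op = 3*i+2 ↔ op = Sum.inr (Sum.inr i) := by
  rcases op with j | j | j <;> simp [opc] <;> omega

theorem set_inc {D : Type} {A B : Set D} (h1 : ∃ e, ∀ e', (e' ∉ A ∧ e' ∈ B) ↔ e' = e)
    (h2 : ∀ e', ¬ (e' ∈ A ∧ e' ∉ B)) : ∃ e, e ∉ A ∧ B = insert e A := by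
  obtain ⟨e, he⟩ := h1
  refine ⟨e, ((he e).2 rfl).1, ?_⟩
  ext x
  have := he x; have := h2 x
  simp only [Set.mem_insert_iff]; tauto
theorem set_dec {D : Type} {A B : Set D} (h1 : ∃ e, ∀ e', (e' ∈ A ∧ e' ∉ B) ↔ e' = e)
    (h2 : ∀ e', ¬ (e' ∉ A ∧ e' ∈ B)) : ∃ e, e ∉ B ∧ A = insert e B := by
  apply set_inc
  · obtain ⟨e, he⟩ := h1
    exact ⟨e, fun e' => by rw [← he, and_comm]⟩
  · intro e' h; exact h2 e' ⟨h.2, h.1⟩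
theorem set_same {D : Type} {A B : Set D} (h1 : ∀ e', ¬ (e' ∈ A ∧ e' ∉ B))
    (h2 : ∀ e', ¬ (e' ∉ A ∧ e' ∈ B)) : B = A := by
  ext x; have := h1 x; have := h2 x; tauto

theorem sat_to_run (M : CMDesc) (q0 qr : ℕ) (h : OmegaDiffSat (redF (M, q0, qr))) :
    ∃ ρ : ℕ → CMConfig, ρ 0 = zeroConfig q0 ∧
    (∀ n, CMStep M (ρ n) (ρ (n+1))) ∧ ∀ n, ∃ m, n ≤ m ∧ (ρ m).1 = qr := by
  classical
  obtain ⟨D, -, val, ⟨t0, d0⟩, h⟩ := h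
  change PS val t0 d0 (redF (M, q0, qr)) at h
  simp only [redF, PS_and, PS_boxP0, PS_allF, PS_someF, PS_dia0] at h
  obtain ⟨hE0, hctr, htr, hrec⟩ := h
  choose τ hτL hτ using fun n : ℕ => htr (t0 + n) (by omega)
  have hq : ∀ n, PS val (t0+n) d0 (excl 1 (τ n).1) := fun n => (hτ n).1
  have hop : ∀ n, PS val (t0+n) d0 (excl 2 (opc (τ n).2.1)) := fun n => (hτ n).2.1
  have hnx : ∀ n, (τ (n+1)).1 = (τ n).2.2 := by
    intro n
    have h1 : PS val (t0+n) d0 (nextF (τ n).2.2) := (hτ n).2.2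
    rw [PS_nextF] at h1
    obtain ⟨e, -, -, h2⟩ := h1
    exact excl_inj val _ _ (hq (n+1)) (h2 d0)
  have hO : ∀ n k, PS val (t0+n) d0 (excl 2 k) ↔ opc (τ n).2.1 = k := by
    intro n k
    constructor
    · intro h; exact excl_inj val _ _ (hop n) h
    · rintro rfl; exact hop n
  let P : ℕ → ℕ → Set D := fun i n => {e | val (3*i+3) (t0+n, e)}
  let InL : ℕ → Prop := fun i => ∃ τ ∈ M.2.2.2, CMOp.counter τ.2.1 = i
  have hP0 : ∀ i, InL i → P i 0 = ∅ := by
    rintro i ⟨τ, hτ, rfl⟩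
    have := ((PS_ctrF val t0 d0 _).1 (hctr τ hτ)).1
    ext e; simpa [P] using this e
  have hPs : ∀ i n, InL i →
      ((τ n).2.1 = Sum.inl i → ∃ e, e ∉ P i n ∧ P i (n+1) = insert e (P i n)) ∧
      ((τ n).2.1 = Sum.inr (Sum.inl i) → ∃ e, e ∉ P i (n+1) ∧ P i n = insert e (P i (n+1))) ∧
      ((τ n).2.1 ≠ Sum.inl i → (τ n).2.1 ≠ Sum.inr (Sum.inl i) → P i (n+1) = P i n) ∧
      ((τ n).2.1 = Sum.inr (Sum.inr i) → P i n = ∅) := by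
    rintro i n ⟨τ', hτ', rfl⟩
    obtain ⟨h1, h2, h3, h4, h5⟩ := ((PS_ctrF val t0 d0 _).1 (hctr τ' hτ')).2.2 (t0+n) (by omega)
    simp only [hO, opc_inc, opc_dec, opc_zero] at h1 h2 h3 h4 h5
    refine ⟨fun h => ?_, fun h => ?_, fun h h' => ?_, fun h => ?_⟩
    · exact set_inc (h1 h) (h4.resolve_left (by rw [h]; simp))
    · exact set_dec (h3 h) (h2.resolve_left (by rw [h]; simp))
    · exact set_same (h4.resolve_left h') (h2.resolve_left h)
    · ext e; simpa [P] using h5 h e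
  have hfin : ∀ i n, InL i → (P i n).Finite := by
    intro i n hi
    induction n with
    | zero => rw [hP0 i hi]; exact Set.finite_empty
    | succ n ih =>
      obtain ⟨h1, h2, h3, -⟩ := hPs i n hi
      by_cases ha : (τ n).2.1 = Sum.inl i
      · obtain ⟨e, -, he⟩ := h1 ha
        rw [he]; exact ih.insert e
      · by_cases hb : (τ n).2.1 = Sum.inr (Sum.inl i)
        · obtain ⟨e, -, he⟩ := h2 hb
          exact ih.subset (he ▸ Set.subset_insert _ _)
        · rw [h3 ha hb]; exact ih
  let c : ℕ → ℕ → ℕ := fun n i => if InL i then (P i n).ncard else 0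
  have hc : ∀ n i, InL i → c n i = (P i n).ncard := fun n i hi => if_pos hi
  have hinL : ∀ n, InL (CMOp.counter (τ n).2.1) := fun n => ⟨τ n, hτL n, rfl⟩
  have hsame : ∀ n j, (τ n).2.1 ≠ Sum.inl j → (τ n).2.1 ≠ Sum.inr (Sum.inl j) →
      c (n+1) j = c n j := by
    intro n j h1 h2
    by_cases hj : InL j
    · rw [hc _ _ hj, hc _ _ hj, (hPs j n hj).2.2.1 h1 h2]
    · simp [c, hj]
  refine ⟨fun n => ((τ n).1, c n), ?_, ?_, ?_⟩
  · have : (τ 0).1 = q0 := excl_inj val _ _ (hq 0) hE0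
    simp only [zeroConfig, Prod.mk.injEq]
    refine ⟨this, ?_⟩
    funext i
    by_cases hi : InL i
    · rw [hc _ _ hi, hP0 i hi]; simp
    · simp [c, hi]
  · intro n
    refine ⟨(τ n).2.1, (τ n).2.2, hτL n, hnx n, ?_⟩
    have hi := hinL n
    rcases hop' : (τ n).2.1 with i | i | i
    · rw [hop'] at hi
      change InL i at hi
      simp only
      refine ⟨?_, fun j hj => hsame n j (by rw [hop']; simpa using Ne.symm hj) (by rw [hop']; simp)⟩
      obtain ⟨e, he, he'⟩ := (hPs i n hi).1 hop'
      rw [hc _ _ hi, hc _ _ hi, he', Set.ncard_insert_of_notMem he (hfin i n hi)]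
    · rw [hop'] at hi
      change InL i at hi
      simp only
      obtain ⟨e, he, he'⟩ := (hPs i n hi).2.1 hop'
      have : c n i = c (n+1) i + 1 := by
        rw [hc _ _ hi, hc _ _ hi, he', Set.ncard_insert_of_notMem he (hfin i (n+1) hi)]
      exact ⟨by omega, by omega,
        fun j hj => hsame n j (by rw [hop']; simp) (by rw [hop']; simpa using Ne.symm hj)⟩
    · rw [hop'] at hi
      change InL i at hi
      simp only
      refine ⟨?_, fun j => hsame n j (by rw [hop']; simp) (by rw [hop']; simp)⟩
      rw [hc _ _ hi, (hPs i n hi).2.2.2 hop']; simp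
  · intro n
    obtain ⟨v, hv, h⟩ := hrec (t0+n) (by omega)
    refine ⟨v - t0, by omega, ?_⟩
    have h2 := hq (v - t0)
    rw [show t0 + (v - t0) = v by omega] at h2
    exact excl_inj val _ _ h2 h

theorem run_to_sat (M : CMDesc) (q0 qr : ℕ) (ρ : ℕ → CMConfig) (h0 : ρ 0 = zeroConfig q0)
    (hstep : ∀ n, CMStep M (ρ n) (ρ (n+1))) (hrec : ∀ n, ∃ m, n ≤ m ∧ (ρ m).1 = qr) :
    OmegaDiffSat (redF (M, q0, qr)) := by
  classical
  choose op q' hL hq' hm using hstep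
  let I : ℕ → ℕ → ℕ := fun i n => Nat.count (fun m => op m = Sum.inl i) n
  let J : ℕ → ℕ → ℕ := fun i n => Nat.count (fun m => op m = Sum.inr (Sum.inl i)) n
  have hI : ∀ i n, I i (n+1) = I i n + if op n = Sum.inl i then 1 else 0 :=
    fun i n => Nat.count_succ _ _
  have hJ : ∀ i n, J i (n+1) = J i n + if op n = Sum.inr (Sum.inl i) then 1 else 0 :=
    fun i n => Nat.count_succ _ _
  have hIJ : ∀ i n, (ρ n).2 i + J i n = I i n := by
    intro i n
    induction n with
    | zero => simp [h0, zeroConfig, I, J]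
    | succ n ih =>
      rw [hI, hJ]
      have hm' := hm n
      rcases ho : op n with j | j | j <;> rw [ho] at hm' <;> simp only at hm' <;>
        by_cases hj : i = j
      · subst hj; simp; omega
      · have := hm'.2 i hj
        have hj' : ¬ j = i := fun h => hj h.symm
        simp [hj']; omega
      · subst hj; simp; omega
      · have := hm'.2.2 i hj
        have hj' : ¬ j = i := fun h => hj h.symm
        simp [hj']; omega
      · have := hm'.2 i
        simp; omega
      · have := hm'.2 i
        simp; omega
  have hImono : ∀ i a b, a ≤ b → I i a ≤ I i b := fun i a b h => Nat.count_monotone _ h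
  have hJmono : ∀ i a b, a ≤ b → J i a ≤ J i b := fun i a b h => Nat.count_monotone _ h
  let val : ℕ → ℕ × ℕ → Prop := fun m p =>
    if m = 0 then p.2 = p.1 else if m % 3 = 1 then (ρ p.1).1 = m / 3
      else if m % 3 = 2 then opc (op p.1) = m / 3
      else J (m/3 - 1) p.1 ≤ p.2 ∧ p.2 < I (m/3-1) p.1
  have v0 : ∀ t d, val 0 (t,d) ↔ d = t := fun t d => by simp [val]
  have v1 : ∀ k t d, val (3*k+1) (t,d) ↔ (ρ t).1 = k := fun k t d => by
    have h1 : (3*k+1) % 3 = 1 := by omega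
    have h2 : (3*k+1) / 3 = k := by omega
    simp [val, h1, h2]
  have v2 : ∀ k t d, val (3*k+2) (t,d) ↔ opc (op t) = k := fun k t d => by
    have h1 : (3*k+2) % 3 = 2 := by omega
    have h2 : (3*k+2) / 3 = k := by omega
    simp [val, h1, h2]
  have v3 : ∀ k t d, val (3*k+3) (t,d) ↔ J k t ≤ d ∧ d < I k t := fun k t d => by
    have h1 : (3*k+3) % 3 = 0 := by omega
    have h2 : (3*k+3) / 3 - 1 = k := by omega
    simp [val, h2]
  have e1 : ∀ k t d, PS val t d (excl 1 k) ↔ (ρ t).1 = k := by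
    intro k t d
    rw [PS_excl]
    simp only [v1]
    constructor
    · exact fun h => h.2
    · intro h; exact ⟨fun j hj h' => by omega, h⟩
  have e2 : ∀ k t d, PS val t d (excl 2 k) ↔ opc (op t) = k := by
    intro k t d
    rw [PS_excl]
    simp only [v2]
    constructor
    · exact fun h => h.2
    · intro h; exact ⟨fun j hj h' => by omega, h⟩
  refine ⟨ℕ, ⟨0⟩, val, (0, 0), ?_⟩
  change PS val 0 0 _
  simp only [redF, PS_and, PS_boxP0, PS_allF, PS_someF, PS_dia0]
  refine ⟨?_, ?_, ?_, ?_⟩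
  · rw [e1, h0]; rfl
  · intro τ _
    generalize CMOp.counter τ.2.1 = i
    rw [PS_ctrF]
    simp only [v3, e2, opc_inc, opc_dec, opc_zero]
    refine ⟨?_, ?_, ?_⟩
    · intro e; simp [I]
    · intro e t u v _ htu huv h1 h2
      change J i u ≤ e ∧ e < I i u
      have := hJmono i u v huv.le
      have := hImono i t u htu.le
      omega
    · intro u _
      have hI' := hI i u
      have hJ' := hJ i u
      have hIJ' := hIJ i u
      have hm' := hm u
      refine ⟨?_, ?_, ?_, ?_, ?_⟩
      · intro ho
        rw [ho] at hI' hJ'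
        simp at hI' hJ'
        exact ⟨I i u, fun e' => by omega⟩
      · by_cases ho : op u = Sum.inl i
        · exact Or.inl ho
        · refine Or.inr fun e' => ?_
          simp only [if_neg ho] at hI'
          have := hJmono i u (u+1) (by omega)
          omega
      · intro ho
        rw [ho] at hI' hJ' hm'
        simp at hI' hJ'
        simp only at hm'
        exact ⟨J i u, fun e' => by omega⟩
      · by_cases ho : op u = Sum.inr (Sum.inl i)
        · exact Or.inl ho
        · refine Or.inr fun e' => ?_
          simp only [if_neg ho] at hJ'
          have := hImono i u (u+1) (by omega)
          omega
      · intro ho e'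
        rw [ho] at hm'
        simp only at hm'
        omega
  · intro u _
    refine ⟨_, hL u, ?_⟩
    simp only [trF, PS_and, PS_nextF, e1, e2, v0]
    refine ⟨trivial, trivial, u+1, rfl, fun v hv => by omega, fun _ => hq' u⟩
  · intro u _
    obtain ⟨m, hm, h⟩ := hrec (u+1)
    exact ⟨m, by omega, (e1 _ _ _).2 h⟩

theorem redF_correct (p : CMDesc × ℕ × ℕ) (hw : CMWF p.1) :
    CMRecur p ↔ OmegaDiffSat (redF p) := by
  obtain ⟨M, q0, qr⟩ := p
  constructor
  · rintro ⟨-, ρ, h1, h2, h3⟩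
    exact run_to_sat M q0 qr ρ h1 h2 h3
  · intro h
    exact ⟨hw, sat_to_run M q0 qr h⟩
end

section
open BForm

/-! ## Part B: computability of the reduction -/

theorem encodeB_inj : Function.Injective encodeB := by
  intro φ
  induction φ with
  | var n => intro ψ h; cases ψ <;> simp [encodeB, Nat.pair_eq_pair] at h <;> simp [h]
  | neg φ ih => 
    intro ψ h; cases ψ <;> simp [encodeB, Nat.pair_eq_pair] at h
    rw [ih h]
  | and φ χ ih1 ih2 => 
    intro ψ h; cases ψ <;> simp [encodeB, Nat.pair_eq_pair] at h
    rw [ih1 h.1, ih2 h.2]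
  | dia0 φ ih => 
    intro ψ h; cases ψ <;> simp [encodeB, Nat.pair_eq_pair] at h
    rw [ih h]
  | dia1 φ ih => 
    intro ψ h; cases ψ <;> simp [encodeB, Nat.pair_eq_pair] at h
    rw [ih h]

section
variable {α : Type} [Primcodable α]

def PF (g : α → BForm) : Prop := Primrec fun a => encodeB (g a)

theorem PF.var {f : α → ℕ} (h : Primrec f) : PF fun a => BForm.var (f a) :=
  Primrec₂.natPair.comp (Primrec.const 0) h
theorem PF.neg {f : α → BForm} (h : PF f) : PF fun a => BForm.neg (f a) :=
  Primrec₂.natPair.comp (Primrec.const 1) h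
theorem PF.and {f g : α → BForm} (h : PF f) (h' : PF g) : PF fun a => BForm.and (f a) (g a) :=
  Primrec₂.natPair.comp (Primrec.const 2) (Primrec₂.natPair.comp h h')
theorem PF.dia0 {f : α → BForm} (h : PF f) : PF fun a => BForm.dia0 (f a) :=
  Primrec₂.natPair.comp (Primrec.const 3) h
theorem PF.dia1 {f : α → BForm} (h : PF f) : PF fun a => BForm.dia1 (f a) :=
  Primrec₂.natPair.comp (Primrec.const 4) h
theorem PF.const (φ : BForm) : PF fun _ : α => φ := Primrec.const _
theorem PF.imp {f g : α → BForm} (h : PF f) (h' : PF g) : PF fun a => BForm.imp (f a) (g a) :=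
  (h.and h'.neg).neg
theorem PF.orF {f g : α → BForm} (h : PF f) (h' : PF g) : PF fun a => HK.orF (f a) (g a) :=
  (h.neg.and h'.neg).neg
theorem PF.diaP1 {f : α → BForm} (h : PF f) : PF fun a => HK.diaP1 (f a) := h.orF h.dia1
theorem PF.noF {f : α → BForm} (h : PF f) : PF fun a => HK.noF (f a) := h.diaP1.neg
theorem PF.ex1F {f : α → BForm} (h : PF f) : PF fun a => HK.ex1F (f a) :=
  (h.and h.dia1.neg).diaP1
theorem PF.boxP0 {f : α → BForm} (h : PF f) : PF fun a => BForm.boxP0 (f a) :=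
  h.and h.neg.dia0.neg
theorem PF.comp {β : Type} [Primcodable β] {g : β → BForm} (h : PF g) {f : α → β} (hf : Primrec f) :
    PF fun a => g (f a) := Primrec.comp (f := fun b => encodeB (g b)) h hf
end

theorem PF_nolit (a : ℕ) : PF (nolit a) := by
  have h : Primrec fun n : ℕ => Nat.rec (motive := fun _ => ℕ) (encodeB top)
      (fun k ih => Nat.pair 2 (Nat.pair ih (Nat.pair 1 (Nat.pair 0 (3*k+a))))) n := by
    apply Primrec.nat_rec₁
    unfold Primrec₂
    refine Primrec₂.natPair.comp (.const 2) (Primrec₂.natPair.comp .snd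
      (Primrec₂.natPair.comp (.const 1) (Primrec₂.natPair.comp (.const 0) ?_)))
    exact Primrec.nat_add.comp (Primrec.nat_mul.comp (.const 3) .fst) (.const a)
  refine h.of_eq fun n => ?_
  induction n with
  | zero => rfl
  | succ n ih => simp only [nolit, encodeB, ← ih]

variable {α : Type} [Primcodable α]

theorem pr_lin {f : α → ℕ} (h : Primrec f) (b : ℕ) : Primrec fun a => 3 * f a + b :=
  Primrec.nat_add.comp (Primrec.nat_mul.comp (.const 3) h) (.const b)

theorem PF.excl {f : α → ℕ} (h : Primrec f) (b : ℕ) : PF fun a => HK.excl b (f a) :=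
  ((PF_nolit b).comp h).and (PF.var (pr_lin h b))

theorem PF.pF {f : α → ℕ} (h : Primrec f) : PF fun a => HK.pF (f a) := PF.var (pr_lin h 3)
theorem PF.inF {f : α → ℕ} (h : Primrec f) : PF fun a => HK.inF (f a) :=
  (PF.pF h).neg.and ((PF.pF h).dia0.and (((PF.pF h).neg.and (PF.pF h).dia0).dia0.neg))
theorem PF.outF {f : α → ℕ} (h : Primrec f) : PF fun a => HK.outF (f a) :=
  (PF.pF h).and (PF.pF h).dia0.neg
theorem PF.convF {f : α → ℕ} (h : Primrec f) : PF fun a => HK.convF (f a) :=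
  ((PF.pF h).and (((PF.pF h).neg.and (PF.pF h).dia0).dia0)).noF
theorem PF.clauseF {f : α → ℕ} (h : Primrec f) : PF fun a => HK.clauseF (f a) := by
  have e0 := PF.excl (pr_lin h 0) 2
  have e1 := PF.excl (pr_lin h 1) 2
  have e2 := PF.excl (pr_lin h 2) 2
  exact (e0.imp (PF.inF h).ex1F).and ((e0.orF (PF.inF h).noF).and
    ((e1.imp (PF.outF h).ex1F).and ((e1.orF (PF.outF h).noF).and
    ((e2.imp (PF.pF h).noF).and (PF.convF h)))))
theorem PF.nextF {f : α → ℕ} (h : Primrec f) : PF fun a => HK.nextF (f a) :=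
  (((PF.const (BForm.neg (BForm.dia0 (BForm.dia0 (BForm.var 0)))))).and
    ((PF.const (BForm.var 0)).and (PF.excl h 1).neg.noF).dia0).diaP1

theorem pr_opc : Primrec opc := by
  have h : Primrec fun o : CMOp => Sum.casesOn (motive := fun _ => ℕ) o (fun i => 3*i+0)
      (fun r : ℕ ⊕ ℕ => Sum.casesOn (motive := fun _ => ℕ) r (fun i => 3*i+1) (fun i => 3*i+2)) :=
    Primrec.sumCasesOn .id (pr_lin .snd 0).to₂
      (Primrec.sumCasesOn .snd (pr_lin .snd 1).to₂ (pr_lin .snd 2).to₂).to₂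
  refine h.of_eq fun o => ?_
  rcases o with i | i | i <;> rfl

theorem pr_counter : Primrec CMOp.counter := by
  have h : Primrec fun o : CMOp => Sum.casesOn (motive := fun _ => ℕ) o (fun i => i)
      (fun r : ℕ ⊕ ℕ => Sum.casesOn (motive := fun _ => ℕ) r (fun i => i) (fun i => i)) :=
    Primrec.sumCasesOn .id Primrec.snd.to₂
      (Primrec.sumCasesOn .snd Primrec.snd.to₂ Primrec.snd.to₂).to₂
  refine h.of_eq fun o => ?_
  rcases o with i | i | i <;> rfl

theorem PF.trF {f : α → ℕ × CMOp × ℕ} (h : Primrec f) : PF fun a => HK.trF (f a) :=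
  (PF.excl (Primrec.fst.comp h) 1).and
   ((PF.excl (pr_opc.comp (Primrec.fst.comp (Primrec.snd.comp h))) 2).and
    (PF.nextF (Primrec.snd.comp (Primrec.snd.comp h))))

theorem PF.ctrF {f : α → ℕ} (h : Primrec f) : PF fun a => HK.ctrF (f a) :=
  (PF.pF h).noF.and (PF.clauseF h).boxP0

theorem PF_allF : PF allF := by
  have h : Primrec fun L : List (ℕ × CMOp × ℕ) => L.foldr (fun τ acc =>
      Nat.pair 2 (Nat.pair (encodeB (ctrF (CMOp.counter τ.2.1))) acc)) (encodeB top) := by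
    refine Primrec.list_foldr (h := fun _ (b : (ℕ × CMOp × ℕ) × ℕ) =>
      Nat.pair 2 (Nat.pair (encodeB (ctrF (CMOp.counter b.1.2.1))) b.2)) .id (.const _) ?_
    unfold Primrec₂
    refine Primrec₂.natPair.comp (.const 2) (Primrec₂.natPair.comp ?_ (Primrec.snd.comp .snd))
    exact PF.ctrF (pr_counter.comp (Primrec.fst.comp (Primrec.snd.comp (Primrec.fst.comp .snd))))
  refine h.of_eq fun L => ?_
  induction L with
  | nil => rfl
  | cons a L ih => simp only [allF, List.foldr_cons, encodeB] at ih ⊢; rw [ih]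

theorem PF_someF : PF someF := by
  have h : Primrec fun L : List (ℕ × CMOp × ℕ) => L.foldr (fun τ acc =>
      Nat.pair 1 (Nat.pair 2 (Nat.pair (encodeB (neg (trF τ))) (Nat.pair 1 acc)))) (encodeB bot) := by
    refine Primrec.list_foldr (h := fun _ (b : (ℕ × CMOp × ℕ) × ℕ) =>
      Nat.pair 1 (Nat.pair 2 (Nat.pair (encodeB (neg (trF b.1))) (Nat.pair 1 b.2)))) .id (.const _) ?_
    unfold Primrec₂
    refine Primrec₂.natPair.comp (.const 1) <|
      Primrec₂.natPair.comp (.const 2) (Primrec₂.natPair.comp ?_ 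
        (Primrec₂.natPair.comp (.const 1) (Primrec.snd.comp .snd)))
    exact (PF.trF (Primrec.fst.comp .snd)).neg
  refine h.of_eq fun L => ?_
  induction L with
  | nil => rfl
  | cons a L ih => simp only [someF, List.foldr_cons, encodeB, orF] at ih ⊢; rw [ih]

theorem PF_redF : PF redF := by
  have hL : Primrec fun p : CMDesc × ℕ × ℕ => p.1.2.2.2 :=
    Primrec.snd.comp (Primrec.snd.comp (Primrec.snd.comp .fst))
  exact (PF.excl (Primrec.fst.comp .snd) 1).and ((PF_allF.comp hL).and
    ((PF_someF.comp hL).boxP0.and (PF.excl (Primrec.snd.comp .snd) 1).dia0.boxP0))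

theorem pr_mem : PrimrecRel fun (q : ℕ) (L : List ℕ) => q ∈ L := by
  have h := (PrimrecRel.exists_mem_list (R := fun a b : ℕ => a = b) Primrec.eq)
  have h2 : PrimrecRel fun (q : ℕ) (L : List ℕ) => ∃ a ∈ L, a = q :=
    h.comp Primrec.snd Primrec.fst
  refine h2.of_eq fun q L => ?_
  simp

theorem pr_CMWF : PrimrecPred CMWF := by
  have h1 : PrimrecPred fun M : CMDesc => 1 < M.1 := Primrec.nat_lt.comp (.const 1) .fst
  have hH : Primrec fun M : CMDesc => M.2.2.1 := Primrec.fst.comp (Primrec.snd.comp .snd)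
  have hI : Primrec fun M : CMDesc => M.2.2.2 := Primrec.snd.comp (Primrec.snd.comp .snd)
  have hS : Primrec fun M : CMDesc => M.2.1 := Primrec.fst.comp .snd
  have h2 : PrimrecPred fun M : CMDesc => ∀ q ∈ M.2.2.1, q < M.2.1 :=
    (PrimrecRel.forall_mem_list Primrec.nat_lt).comp hH hS
  have h3 : PrimrecPred fun M : CMDesc => ∀ t ∈ M.2.2.2,
      t.1 < M.2.1 ∧ t.1 ∉ M.2.2.1 ∧ t.2.2 < M.2.1 ∧ CMOp.counter t.2.1 < M.1 := by
    have : PrimrecRel fun (t : ℕ × CMOp × ℕ) (M : CMDesc) =>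
        t.1 < M.2.1 ∧ t.1 ∉ M.2.2.1 ∧ t.2.2 < M.2.1 ∧ CMOp.counter t.2.1 < M.1 := by
      have ht1 : Primrec fun x : (ℕ × CMOp × ℕ) × CMDesc => x.1.1 := Primrec.fst.comp .fst
      have ht2 : Primrec fun x : (ℕ × CMOp × ℕ) × CMDesc => x.1.2.2 :=
        Primrec.snd.comp (Primrec.snd.comp .fst)
      have ht3 : Primrec fun x : (ℕ × CMOp × ℕ) × CMDesc => CMOp.counter x.1.2.1 :=
        pr_counter.comp (Primrec.fst.comp (Primrec.snd.comp .fst))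
      refine PrimrecPred.and (Primrec.nat_lt.comp ht1 (hS.comp .snd)) (PrimrecPred.and
        (PrimrecPred.not (pr_mem.comp ht1 (hH.comp .snd))) (PrimrecPred.and 
          (Primrec.nat_lt.comp ht2 (hS.comp .snd)) (Primrec.nat_lt.comp ht3 (Primrec.fst.comp .snd))))
    exact (PrimrecRel.forall_mem_list this).comp hI .id
  have h4 : PrimrecPred fun M : CMDesc => ∀ q ∈ List.range M.2.1, q ∈ M.2.2.1 ∨
      ∃ t ∈ M.2.2.2, t.1 = q := by
    have : PrimrecRel fun (q : ℕ) (M : CMDesc) => q ∈ M.2.2.1 ∨ ∃ t ∈ M.2.2.2, t.1 = q := by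
      refine PrimrecPred.or (pr_mem.comp .fst (hH.comp .snd)) ?_
      have : PrimrecRel fun (t : ℕ × CMOp × ℕ) (q : ℕ) => t.1 = q :=
        Primrec.eq.comp (Primrec.fst.comp .fst) .snd
      exact (PrimrecRel.exists_mem_list this).comp (hI.comp .snd) .fst
    exact (PrimrecRel.forall_mem_list this).comp (Primrec.list_range.comp hS) .id
  refine (h1.and (h2.and (h3.and h4))).of_eq fun M => ?_
  unfold CMWF
  simp only [List.mem_range, or_iff_not_imp_left]

theorem not_sat_bot : ¬ OmegaDiffSat bot := by
  rintro ⟨W, _, val, x, h⟩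
  exact h.2 h.1

open Classical in
theorem CMRecur_le : ManyOneReducible CMRecur (BCodes OmegaDiffSat) := by
  refine ⟨fun p => if CMWF p.1 then encodeB (redF p) else encodeB bot, ?_, ?_⟩
  · exact (Primrec.ite (pr_CMWF.comp .fst) PF_redF (.const _)).to_comp
  · intro p
    by_cases hw : CMWF p.1
    · simp only [if_pos hw]
      rw [redF_correct p hw]
      constructor
      · intro h; exact ⟨_, rfl, h⟩
      · rintro ⟨φ, h1, h2⟩
        rwa [← encodeB_inj h1]
    · simp only [if_neg hw]
      constructor
      · intro h; exact absurd h.1 hw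
      · rintro ⟨φ, h1, h2⟩
        rw [encodeB_inj h1] at h2
        exact absurd h2 not_sat_bot
end

section
open Relation

/-! ## Part C: regular programs compile to counter machines -/

def opRel : Option CMOp → (ℕ → ℕ) → (ℕ → ℕ) → Prop
  | none, c, c' => c' = c
  | some (Sum.inl i), c, c' => c' = Function.update c i (c i + 1)
  | some (Sum.inr (Sum.inl i)), c, c' => 0 < c i ∧ c' = Function.update c i (c i - 1)
  | some (Sum.inr (Sum.inr i)), c, c' => c i = 0 ∧ c' = c

def GStep {S : Type} (E : List (S × Option CMOp × S)) (x y : S × (ℕ → ℕ)) : Prop :=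
  ∃ o, (x.1, o, y.1) ∈ E ∧ opRel o x.2 y.2

/-- the relation `ρ` is realized by a finite graph. -/
def Compilable (ρ : (ℕ → ℕ) → (ℕ → ℕ) → Prop) : Prop :=
  ∃ (S : Type) (_ : Finite S) (s f : S) (E : List (S × Option CMOp × S)),
    ∀ c c', ReflTransGen (GStep E) (s, c) (f, c') ↔ ρ c c'

theorem Compilable.op (o : Option CMOp) : Compilable (opRel o) := by
  refine ⟨Bool, inferInstance, false, true, [(false, o, true)], fun c c' => ?_⟩
  constructor
  · intro h
    rcases ReflTransGen.cases_head h with h | ⟨⟨b, d⟩, ⟨o', h1, h2⟩, h3⟩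
    · simp at h
    · simp at h1
      obtain ⟨rfl, rfl⟩ := h1
      rcases ReflTransGen.cases_head h3 with h | ⟨⟨b, d⟩, ⟨o', h1, _⟩, h3⟩
      · simp at h; subst h; exact h2
      · simp at h1
  · intro h
    exact ReflTransGen.single ⟨o, by simp, h⟩

theorem RTG_lift {X Y : Type} {r : X → X → Prop} {p : Y → Y → Prop} (f : X → Y)
    (h : ∀ a b, r a b → ReflTransGen p (f a) (f b)) {a b : X} (hab : ReflTransGen r a b) :
    ReflTransGen p (f a) (f b) := ReflTransGen.lift' f h _ _ hab

theorem Compilable.seq {ρ₁ ρ₂} (h₁ : Compilable ρ₁) (h₂ : Compilable ρ₂) :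
    Compilable (Relation.Comp ρ₁ ρ₂) := by
  obtain ⟨S₁, _, s₁, f₁, E₁, H₁⟩ := h₁
  obtain ⟨S₂, _, s₂, f₂, E₂, H₂⟩ := h₂
  set E : List ((S₁ ⊕ S₂) × Option CMOp × (S₁ ⊕ S₂)) :=
    E₁.map (fun t => (Sum.inl t.1, t.2.1, Sum.inl t.2.2)) ++
    (E₂.map (fun t => (Sum.inr t.1, t.2.1, Sum.inr t.2.2)) ++ [(Sum.inl f₁, none, Sum.inr s₂)]) with hE
  refine ⟨S₁ ⊕ S₂, inferInstance, Sum.inl s₁, Sum.inr f₂, E, fun c c' => ?_⟩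
  constructor
  · intro h
    have key : ∀ x, ReflTransGen (GStep E) x (Sum.inr f₂, c') →
        (∀ a, x.1 = Sum.inl a → ∃ d, ReflTransGen (GStep E₁) (a, x.2) (f₁, d) ∧
          ReflTransGen (GStep E₂) (s₂, d) (f₂, c')) ∧
        (∀ a, x.1 = Sum.inr a → ReflTransGen (GStep E₂) (a, x.2) (f₂, c')) := by
      intro x hx
      induction hx using ReflTransGen.head_induction_on with
      | refl =>
        refine ⟨by simp, ?_⟩
        intro a ha
        simp at ha; subst ha; exact .refl
      | @head x y h1 _ ih =>
        obtain ⟨x, c⟩ := x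
        obtain ⟨y, d⟩ := y
        obtain ⟨o, h1, h2⟩ := h1
        simp only [hE, List.mem_append, List.mem_map, List.mem_singleton, Prod.mk.injEq] at h1
        rcases h1 with ⟨⟨a, o', b⟩, h3, rfl, rfl, rfl⟩ | ⟨⟨a, o', b⟩, h3, rfl, rfl, rfl⟩ | ⟨rfl, rfl, rfl⟩
        · simp at ih h2
          obtain ⟨d', k1, k2⟩ := ih
          refine ⟨?_, by simp⟩
          intro a' ha; simp at ha; subst ha
          exact ⟨d', .head ⟨o', h3, h2⟩ k1, k2⟩
        · simp at ih h2
          refine ⟨by simp, ?_⟩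
          intro a' ha; simp at ha; subst ha
          exact .head ⟨o', h3, h2⟩ ih
        · simp at ih h2
          simp only [opRel] at h2
          subst h2
          refine ⟨?_, by simp⟩
          intro a' ha; simp at ha; subst ha
          exact ⟨_, .refl, ih⟩
    obtain ⟨d, k1, k2⟩ := (key _ h).1 _ rfl
    exact ⟨d, (H₁ _ _).1 k1, (H₂ _ _).1 k2⟩
  · rintro ⟨d, h1, h2⟩
    have l1 := RTG_lift (p := GStep E) (fun x : S₁ × (ℕ → ℕ) => (Sum.inl x.1, x.2))
      (by rintro ⟨a, x⟩ ⟨b, y⟩ ⟨o, k1, k2⟩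
          exact .single ⟨o, by simp only [hE, List.mem_append, List.mem_map]; left; exact ⟨_, k1, rfl⟩, k2⟩) ((H₁ _ _).2 h1)
    have l2 := RTG_lift (p := GStep E) (fun x : S₂ × (ℕ → ℕ) => (Sum.inr x.1, x.2))
      (by rintro ⟨a, x⟩ ⟨b, y⟩ ⟨o, k1, k2⟩
          exact .single ⟨o, by simp only [hE, List.mem_append, List.mem_map]; right; left; exact ⟨_, k1, rfl⟩, k2⟩) ((H₂ _ _).2 h2)
    have l3 : GStep E (Sum.inl f₁, d) (Sum.inr s₂, d) := ⟨none, by simp [hE], rfl⟩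
    exact l1.trans (ReflTransGen.head l3 l2)

theorem Compilable.star {ρ} (h : Compilable ρ) : Compilable (ReflTransGen ρ) := by
  obtain ⟨S₁, _, s₁, f₁, E₁, H₁⟩ := h
  set E : List ((Option S₁) × Option CMOp × (Option S₁)) :=
    E₁.map (fun t => (some t.1, t.2.1, some t.2.2)) ++ [(none, none, some s₁), (some f₁, none, none)] with hE
  refine ⟨Option S₁, inferInstance, none, none, E, fun c c' => ?_⟩
  constructor
  · intro h
    have key : ∀ x, ReflTransGen (GStep E) x (none, c') →
        (∀ a, x.1 = some a → ∃ d, ReflTransGen (GStep E₁) (a, x.2) (f₁, d) ∧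
          ReflTransGen ρ d c') ∧
        (x.1 = none → ReflTransGen ρ x.2 c') := by
      intro x hx
      induction hx using ReflTransGen.head_induction_on with
      | refl => exact ⟨by simp, fun _ => .refl⟩
      | @head x y h1 _ ih =>
        obtain ⟨x, c⟩ := x
        obtain ⟨y, d⟩ := y
        obtain ⟨o, h1, h2⟩ := h1
        simp only [hE, List.mem_append, List.mem_map, List.mem_cons, List.not_mem_nil, or_false, Prod.mk.injEq] at h1
        rcases h1 with ⟨⟨a, o', b⟩, h3, rfl, rfl, rfl⟩ | ⟨rfl, rfl, rfl⟩ | ⟨rfl, rfl, rfl⟩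
        · simp at ih h2
          obtain ⟨d', k1, k2⟩ := ih
          refine ⟨?_, by simp⟩
          intro a' ha; simp at ha; subst ha
          exact ⟨d', .head ⟨o', h3, h2⟩ k1, k2⟩
        · simp at ih h2
          simp only [opRel] at h2
          subst h2
          refine ⟨by simp, fun _ => ?_⟩
          obtain ⟨d', k1, k2⟩ := ih
          exact .head ((H₁ _ _).1 k1) k2
        · simp at ih h2
          simp only [opRel] at h2
          subst h2
          refine ⟨?_, by simp⟩
          intro a' ha; simp at ha; subst ha
          exact ⟨_, .refl, ih⟩
    exact (key _ h).2 rfl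
  · intro h
    refine RTG_lift (fun c : ℕ → ℕ => ((none : Option S₁), c)) ?_ h
    intro a b hab
    have l1 := RTG_lift (p := GStep E) (fun x : S₁ × (ℕ → ℕ) => (some x.1, x.2))
      (by rintro ⟨a, x⟩ ⟨b, y⟩ ⟨o, k1, k2⟩
          exact .single ⟨o, by simp only [hE, List.mem_append, List.mem_map]; left; exact ⟨_, k1, rfl⟩, k2⟩) ((H₁ _ _).2 hab)
    have l2 : GStep E (none, a) (some s₁, a) := ⟨none, by simp [hE], rfl⟩
    have l3 : GStep E (some f₁, b) (none, b) := ⟨none, by simp [hE], rfl⟩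
    exact ReflTransGen.head l2 (ReflTransGen.tail l1 l3)

/-- paths of given length -/
def LenP {X : Type} (T : X → X → Prop) : ℕ → X → X → Prop
  | 0, x, y => x = y
  | j+1, x, y => ∃ z, T x z ∧ LenP T j z y

theorem LenP_of {X : Type} {T : X → X → Prop} {x y : X} (h : ReflTransGen T x y) :
    ∃ j, LenP T j x y := by
  induction h using ReflTransGen.head_induction_on with
  | refl => exact ⟨0, rfl⟩
  | head h _ ih => obtain ⟨j, hj⟩ := ih; exact ⟨j+1, _, h, hj⟩

theorem inf_run {X : Type} {T : X → X → Prop} (x : X) (y : ℕ → X)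
    (h0 : ReflTransGen T x (y 0)) (h : ∀ k, TransGen T (y k) (y (k+1))) :
    ∃ r : ℕ → X, r 0 = x ∧ (∀ n, T (r n) (r (n+1))) ∧ ∀ n, ∃ m, n ≤ m ∧ ∃ k, r m = y k := by
  have nx : ∀ a : {a : X × ℕ × ℕ // LenP T a.2.2 a.1 (y a.2.1)},
      ∃ b : {a : X × ℕ × ℕ // LenP T a.2.2 a.1 (y a.2.1)}, T a.1.1 b.1.1 ∧
        (a.1.2.2 ≠ 0 → b.1.2.2 + 1 = a.1.2.2) := by
    rintro ⟨⟨x, k, j⟩, ha⟩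
    cases j with
    | zero =>
      simp only [LenP] at ha
      subst ha
      obtain ⟨z, h1, h2⟩ := TransGen.head'_iff.1 (h k)
      obtain ⟨j, hj⟩ := LenP_of h2
      exact ⟨⟨(z, k+1, j), hj⟩, h1, by simp⟩
    | succ j =>
      obtain ⟨z, h1, h2⟩ := ha
      exact ⟨⟨(z, k, j), h2⟩, h1, by simp⟩
  choose g hg1 hg2 using nx
  obtain ⟨j, hj⟩ := LenP_of h0
  set st : ℕ → {a : X × ℕ × ℕ // LenP T a.2.2 a.1 (y a.2.1)} := fun n => g^[n] ⟨(x, 0, j), hj⟩ with hst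
  have hs : ∀ n, st (n+1) = g (st n) := fun n => Function.iterate_succ_apply' _ _ _
  refine ⟨fun n => (st n).1.1, rfl, ?_, ?_⟩
  · intro n
    simp only [hs]
    exact hg1 _
  · have : ∀ j n, (st n).1.2.2 = j → ∃ m, n ≤ m ∧ ∃ k, (st m).1.1 = y k := by
      intro j
      induction j with
      | zero =>
        intro n hn
        refine ⟨n, le_rfl, (st n).1.2.1, ?_⟩
        · have := (st n).2
          rw [hn] at this
          exact this
      | succ j ih =>
        intro n hn
        have := hg2 (st n) (by omega)
        rw [← hs] at this
        obtain ⟨m, h1, h2⟩ := ih (n+1) (by omega)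
        exact ⟨m, by omega, h2⟩
    exact fun n => this _ n rfl
end

section
open Relation

/-- translation of graph operations to machine operations, with an always-zero counter `Z`. -/
def opTr (Z : ℕ) : Option CMOp → CMOp
  | none => Sum.inr (Sum.inr Z)
  | some o => o

theorem CMStep_iff {M : CMDesc} {q c q' c'} : CMStep M (q, c) (q', c') ↔
    ∃ op, (q, op, q') ∈ M.2.2.2 ∧ opRel (some op) c c' := by
  constructor
  · rintro ⟨op, q1, h1, h2, h3⟩
    simp only at h1 h2
    subst h2
    refine ⟨op, h1, ?_⟩
    rcases op with i | i | i <;> simp only [opRel] at h3 ⊢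
    · funext j
      by_cases hj : j = i
      · subst hj; simp [h3.1]
      · simp [hj, h3.2 j hj]
    · refine ⟨h3.1, ?_⟩
      funext j
      by_cases hj : j = i
      · subst hj; simp; omega
      · simp [hj, h3.2.2 j hj]
    · exact ⟨h3.1, funext h3.2⟩
  · rintro ⟨op, h1, h2⟩
    refine ⟨op, q', h1, rfl, ?_⟩
    rcases op with i | i | i <;> simp only [opRel] at h2 ⊢
    · subst h2; simp +contextual [Function.update_of_ne]
    · obtain ⟨h3, rfl⟩ := h2
      refine ⟨h3, by simp; omega, ?_⟩
      simp +contextual [Function.update_of_ne]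
    · obtain ⟨h3, rfl⟩ := h2
      exact ⟨h3, fun _ => rfl⟩

theorem opRel_opTr {Z : ℕ} {o c c'} (h : opRel (some (opTr Z o)) c c') : opRel o c c' := by
  cases o with
  | none => exact h.2
  | some o => exact h

theorem opRel_opTr' {Z : ℕ} {o c c'} (hZ : c Z = 0) (h : opRel o c c') :
    opRel (some (opTr Z o)) c c' := by
  cases o with
  | none => exact ⟨hZ, h⟩
  | some o => exact h

theorem opRel_zero {Z : ℕ} {o c c'} (hZ : c Z = 0) (ho : ∀ o', o = some o' → CMOp.counter o' < Z)
    (h : opRel o c c') : c' Z = 0 := by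
  rcases o with _ | i | i | i <;> simp only [opRel] at h
  · rw [h, hZ]
  · have := ho _ rfl
    simp only [CMOp.counter] at this
    rw [h, Function.update_of_ne (by omega), hZ]
  · have := ho _ rfl
    simp only [CMOp.counter] at this
    rw [h.2, Function.update_of_ne (by omega), hZ]
  · rw [h.2, hZ]

open Classical in
theorem compile_recur (ρ : (ℕ → ℕ) → (ℕ → ℕ) → Prop) (hρ : Compilable ρ) :
    ∃ F : ℕ → CMDesc × ℕ × ℕ, Primrec F ∧ ∀ m, CMRecur (F m) ↔
      ∃ s : ℕ → (ℕ → ℕ), s 0 = Function.update (fun _ => 0) 0 m ∧ ∀ k, ρ (s k) (s (k+1)) := by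
  obtain ⟨S, _, s₀, f₀, E, H⟩ := hρ
  obtain ⟨K, ⟨e⟩⟩ := Finite.exists_equiv_fin S
  have hb : ∃ Z : ℕ, 0 < Z ∧ ∀ a o b, (a, some o, b) ∈ E → CMOp.counter o < Z := by
    refine ⟨(E.map fun t => match t.2.1 with | none => 0 | some o => CMOp.counter o).sum + 1, by omega, ?_⟩
    intro a o b h
    have := List.single_le_sum (l := E.map fun t => match t.2.1 with | none => 0 | some o => CMOp.counter o) (by simp) (CMOp.counter o) (List.mem_map.2 ⟨_, h, rfl⟩)
    omega
  obtain ⟨Z, hZ0, hZ⟩ := hb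
  set zt : CMOp := Sum.inr (Sum.inr Z) with hzt
  set code : S → ℕ := fun a => (e a : ℕ) with hcode
  have codelt : ∀ a, code a < K := fun a => (e a).2
  have codeinj : ∀ a b, code a = code b → a = b := fun a b h => e.injective (Fin.ext h)
  set I0 : List (ℕ × CMOp × ℕ) := E.map (fun t => (code t.1, opTr Z t.2.1, code t.2.2)) ++
    [(K, zt, code s₀), (code f₀, zt, K)] with hI0
  set T : List ℕ := (List.range K).filter (fun q => ¬ ∃ t ∈ I0, t.1 = q) with hT
  set I : ℕ → List (ℕ × CMOp × ℕ) := fun m => I0 ++ (List.range m).map (fun i => (K+i+1, Sum.inl 0, K+i)) with hI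
  set F : ℕ → CMDesc × ℕ × ℕ := fun m => ((Z+1, K+m+1, T, I m), K+m, K) with hF
  refine ⟨F, ?_, ?_⟩
  · have hKm : Primrec fun m : ℕ => K + m := Primrec.nat_add.comp (.const K) .id
    refine Primrec.pair (Primrec.pair (.const _) (Primrec.pair (Primrec.succ.comp hKm)
      (Primrec.pair (.const _) ?_))) (Primrec.pair hKm (.const K))
    refine Primrec.list_append.comp (.const _) (Primrec.list_map .list_range ?_)
    have hKi : Primrec fun x : ℕ × ℕ => K + x.2 := hKm.comp .snd
    exact Primrec.pair (Primrec.succ.comp hKi) (Primrec.pair (.const _) hKi)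
  intro m
  have memI : ∀ t, t ∈ I m ↔ (∃ a o b, (a, o, b) ∈ E ∧ t = (code a, opTr Z o, code b)) ∨
      t = (K, zt, code s₀) ∨ t = (code f₀, zt, K) ∨ ∃ i, i < m ∧ t = (K+i+1, Sum.inl 0, K+i) := by
    intro t
    simp only [hI, hI0, List.mem_append, List.mem_map, List.mem_cons, List.mem_range, List.not_mem_nil,
      or_false, Prod.exists, or_assoc, eq_comm]
  have wf : CMWF (F m).1 := by
    refine ⟨by simp [hF]; omega, ?_, ?_, ?_⟩
    · intro q hq
      simp only [hF, hT, List.mem_filter, List.mem_range] at hq ⊢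
      omega
    · intro t ht
      simp only [hF] at ht ⊢
      have hsrc : t.1 ∉ T := by
        intro h
        simp only [hT, List.mem_filter, List.mem_range, decide_eq_true_eq] at h
        rcases List.mem_append.1 ht with h' | h'
        · exact h.2 ⟨t, h', rfl⟩
        · obtain ⟨i, _, rfl⟩ := List.mem_map.1 h'
          have := h.1
          simp only at this
          omega
      refine ⟨?_, hsrc, ?_⟩
      · rcases (memI t).1 ht with ⟨a, o, b, h, rfl⟩ | rfl | rfl | ⟨i, hi, rfl⟩ <;> simp only
        · have := codelt a; omega
        · omega
        · have := codelt f₀; omega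
        · omega
      · rcases (memI t).1 ht with ⟨a, o, b, h, rfl⟩ | rfl | rfl | ⟨i, hi, rfl⟩ <;> simp only
        · have := codelt b
          refine ⟨by omega, ?_⟩
          cases o with
          | none => simp [opTr, CMOp.counter]
          | some o => have := hZ _ _ _ h; simp only [opTr]; omega
        · have := codelt s₀
          exact ⟨by omega, by simp [hzt, CMOp.counter]⟩
        · exact ⟨by omega, by simp [hzt, CMOp.counter]⟩
        · exact ⟨by omega, by simp [CMOp.counter]⟩
    · intro q hq hn
      simp only [hF] at hq hn ⊢
      rcases lt_trichotomy q K with h | h | h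
      · simp only [hT, List.mem_filter, List.mem_range, decide_eq_true_eq, not_and, not_not] at hn
        obtain ⟨t, h1, h2⟩ := hn h
        exact ⟨t, List.mem_append_left _ h1, h2⟩
      · exact ⟨_, (memI _).2 (Or.inr (Or.inl rfl)), h.symm⟩
      · exact ⟨(K + (q-K-1) + 1, Sum.inl 0, K + (q-K-1)),
          (memI _).2 (Or.inr (Or.inr (Or.inr ⟨_, by omega, rfl⟩))), by simp only; omega⟩
  set St := CMStep (F m).1 with hSt
  have stepI : ∀ {q c q' c'}, St (q, c) (q', c') ↔ ∃ op, (q, op, q') ∈ I m ∧ opRel (some op) c c' :=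
    fun {q c q' c'} => CMStep_iff
  -- graph paths to machine paths
  have g2m : ∀ x y, ReflTransGen (GStep E) x y → x.2 Z = 0 →
      ReflTransGen St (code x.1, x.2) (code y.1, y.2) ∧ y.2 Z = 0 := by
    intro x y h h0
    induction h with
    | refl => exact ⟨.refl, h0⟩
    | @tail y z _ h1 ih =>
      obtain ⟨o, k1, k2⟩ := h1
      refine ⟨ih.1.tail (stepI.2 ⟨opTr Z o, (memI _).2 (Or.inl ⟨_, _, _, k1, rfl⟩), opRel_opTr' ih.2 k2⟩), ?_⟩
      refine opRel_zero ih.2 ?_ k2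
      rintro o' rfl
      exact hZ _ _ _ k1
  -- machine paths to `K` decoded
  have m2g : ∀ x c', ReflTransGen St x (K, c') →
      (∀ a, x.1 = code a → ∃ d, ReflTransGen (GStep E) (a, x.2) (f₀, d) ∧ ReflTransGen ρ d c') ∧
      (∀ i, x.1 = K + i → ReflTransGen ρ (Function.update x.2 0 (x.2 0 + i)) c') := by
    intro x c' h
    induction h using ReflTransGen.head_induction_on with
    | refl =>
      refine ⟨fun a h => ?_, fun i h => ?_⟩
      · have := codelt a; simp only at h; omega
      · simp only at h
        obtain rfl : i = 0 := by omega
        simp only [add_zero, Function.update_eq_self]; exact .refl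
    | @head x y h1 _ ih =>
      obtain ⟨q, c⟩ := x
      obtain ⟨q', d⟩ := y
      obtain ⟨op, h1, h2⟩ := stepI.1 h1
      rcases (memI _).1 h1 with ⟨a, o, b, h, h3⟩ | h3 | h3 | ⟨i, hi, h3⟩ <;>
        simp only [Prod.mk.injEq] at h3 <;> obtain ⟨rfl, rfl, rfl⟩ := h3
      · refine ⟨fun a' h' => ?_, fun i h => ?_⟩
        · obtain rfl := codeinj _ _ h'
          obtain ⟨d', k1, k2⟩ := ih.1 b rfl
          exact ⟨d', .head ⟨o, h, opRel_opTr h2⟩ k1, k2⟩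
        · have := codelt a; simp only at h; omega
      · refine ⟨fun a' h' => ?_, fun i h => ?_⟩
        · have := codelt a'; simp only at h'; omega
        · simp only at h
          obtain rfl : i = 0 := by omega
          obtain ⟨d', k1, k2⟩ := ih.1 s₀ rfl
          obtain rfl : d = c := h2.2
          simp only [add_zero, Function.update_eq_self]
          exact .head ((H _ _).1 k1) k2
      · refine ⟨fun a' h' => ?_, fun i h => ?_⟩
        · obtain rfl := codeinj _ _ h'
          have := ih.2 0 rfl
          simp only [add_zero, Function.update_eq_self] at this
          obtain rfl : d = c := h2.2
          exact ⟨_, .refl, this⟩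
        · have := codelt f₀; simp only at h; omega
      · refine ⟨fun a' h' => ?_, fun i' h => ?_⟩
        · have := codelt a'; simp only at h'; omega
        · simp only at h
          obtain rfl : i' = i + 1 := by omega
          have := ih.2 i rfl
          simp only [opRel] at h2
          subst h2
          simp only [Function.update_self, Function.update_idem] at this ⊢
          rw [show c 0 + (i+1) = c 0 + 1 + i by omega]
          exact this
  constructor
  · rintro ⟨-, r, r0, rs, rv⟩
    obtain ⟨φ, hφ, hK⟩ := Nat.exists_strictMono_subsequence (P := fun n => (r n).1 = K) (by
      intro N
      obtain ⟨m, h1, h2⟩ := rv (N+1)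
      exact ⟨m, by omega, h2⟩)
    have path : ∀ n j, ReflTransGen St (r n) (r (n+j)) := by
      intro n j
      induction j with
      | zero => exact .refl
      | succ j ih => exact ih.tail (rs _)
    have path' : ∀ a b, a ≤ b → ReflTransGen St (r a) (r b) := by
      intro a b h
      have := path a (b-a)
      rwa [Nat.add_sub_cancel' h] at this
    have rφ : ∀ k, r (φ k) = (K, (r (φ k)).2) := fun k => Prod.ext (hK k) rfl
    have A := inf_run (T := ρ) (Function.update (fun _ => 0) 0 m) (fun k => (r (φ k)).2)
    refine (A ?_ ?_).imp fun s hs => ⟨hs.1, hs.2.1⟩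
    · have h := path' 0 (φ 0) (by omega)
      rw [rφ] at h
      have := (m2g _ _ h).2 m (by rw [r0]; rfl)
      rw [r0] at this
      simpa [zeroConfig] using this
    · intro k
      have h1 := rs (φ k)
      have h2 := path' (φ k + 1) (φ (k+1)) (hφ (by omega))
      generalize r (φ k + 1) = y at h1 h2
      rw [rφ (k+1)] at h2
      rw [rφ k] at h1
      obtain ⟨q', d⟩ := y
      obtain ⟨op, h1, h3⟩ := stepI.1 h1
      rcases (memI _).1 h1 with ⟨a, o, b, h, h4⟩ | h4 | h4 | ⟨i, hi, h4⟩ <;>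
        simp only [Prod.mk.injEq] at h4
      · have := codelt a; omega
      · obtain ⟨-, rfl, rfl⟩ := h4
        obtain ⟨d', k1, k2⟩ := (m2g _ _ h2).1 s₀ rfl
        have h5 := h3.2
        simp only at h5 k1
        rw [h5] at k1
        exact TransGen.head' ((H _ _).1 k1) k2
      · have := codelt f₀; omega
      · omega
  · rintro ⟨s, s0, ss⟩
    have sZ : ∀ k, s k Z = 0 := by
      intro k
      induction k with
      | zero => rw [s0, Function.update_of_ne (by omega)]
      | succ k ih => exact (g2m _ _ ((H _ _).2 (ss k)) ih).2
    have load : ∀ i, i ≤ m → ∀ c, ReflTransGen St (K + i, c) (K, Function.update c 0 (c 0 + i)) := by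
      intro i
      induction i with
      | zero => intro _ c; simp only [add_zero, Function.update_eq_self]; exact .refl
      | succ i ih =>
        intro hi c
        have h1 : St (K + (i+1), c) (K + i, Function.update c 0 (c 0 + 1)) :=
          stepI.2 ⟨Sum.inl 0, (memI _).2 (Or.inr (Or.inr (Or.inr ⟨i, by omega, rfl⟩))), rfl⟩
        have h2 := ih (by omega) (Function.update c 0 (c 0 + 1))
        simp only [Function.update_self, Function.update_idem] at h2
        rw [show c 0 + (i+1) = c 0 + 1 + i by omega]
        exact .head h1 h2
    have A := inf_run (T := St) (zeroConfig (K+m)) (fun k => (K, s k))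
    refine ⟨wf, (A ?_ ?_).imp fun r hr => ⟨hr.1, hr.2.1, fun n => ?_⟩⟩
    rotate_left 2
    · obtain ⟨m, h1, k, h2⟩ := hr.2.2 n
      exact ⟨m, h1, by rw [h2]⟩
    · have := load m le_rfl (fun _ => 0)
      simp only [s0]
      simpa [zeroConfig] using this
    · intro k
      have h1 : St (K, s k) (code s₀, s k) := stepI.2 ⟨zt, (memI _).2 (Or.inr (Or.inl rfl)), sZ k, rfl⟩
      have h2 := (g2m _ _ ((H _ _).2 (ss k)) (sZ k)).1
      have h3 : St (code f₀, s (k+1)) (K, s (k+1)) :=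
        stepI.2 ⟨zt, (memI _).2 (Or.inr (Or.inr (Or.inl rfl))), sZ (k+1), rfl⟩
      exact TransGen.head' h1 (h2.tail h3)
end

section
open Relation

/-! ## Part D: primitive recursive functions are compilable -/

def CF (P : (ℕ → ℕ) → Prop) (g : (ℕ → ℕ) → (ℕ → ℕ)) : Prop :=
  ∃ ρ, Compilable ρ ∧ ∀ c, P c → ∀ c', ρ c c' ↔ c' = g c

theorem CF.congr {P P' g g'} (h : CF P g) (h1 : ∀ c, P' c → P c) (h2 : ∀ c, P' c → g c = g' c) :
    CF P' g' := by
  obtain ⟨ρ, k1, k2⟩ := h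
  refine ⟨ρ, k1, fun c hc c' => ?_⟩
  rw [k2 c (h1 c hc), h2 c hc]

theorem CF.seq {P Q g h} (hg : CF P g) (hh : CF Q h) (hPQ : ∀ c, P c → Q (g c)) :
    CF P (fun c => h (g c)) := by
  obtain ⟨ρ, k1, k2⟩ := hg
  obtain ⟨σ, l1, l2⟩ := hh
  refine ⟨_, k1.seq l1, fun c hc c' => ?_⟩
  constructor
  · rintro ⟨d, h1, h2⟩
    rw [k2 c hc] at h1
    subst h1
    exact (l2 _ (hPQ c hc) _).1 h2
  · intro h
    exact ⟨g c, (k2 c hc _).2 rfl, (l2 _ (hPQ c hc) _).2 h⟩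

theorem CF.inc (i : ℕ) : CF (fun _ => True) (fun c => Function.update c i (c i + 1)) :=
  ⟨_, Compilable.op (some (Sum.inl i)), fun _ _ _ => Iff.rfl⟩

theorem CF.skip : CF (fun _ => True) (fun c => c) :=
  ⟨_, Compilable.op none, fun _ _ _ => Iff.rfl⟩

theorem CF.loop {P Q B} {h : (ℕ → ℕ) → (ℕ → ℕ)} (i : ℕ) (hB : CF Q B)
    (h1 : ∀ c, P c → 0 < c i → Q (Function.update c i (c i - 1)))
    (h2 : ∀ c, P c → 0 < c i → P (B (Function.update c i (c i - 1))))
    (h3 : ∀ c, P c → 0 < c i → (B (Function.update c i (c i - 1))) i = c i - 1)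
    (h4 : ∀ c, P c → 0 < c i → h (B (Function.update c i (c i - 1))) = h c)
    (h5 : ∀ c, P c → c i = 0 → h c = c) : CF P h := by
  obtain ⟨β, k1, k2⟩ := hB
  refine ⟨_, (((Compilable.op (some (Sum.inr (Sum.inl i)))).seq k1).star).seq
    (Compilable.op (some (Sum.inr (Sum.inr i)))), fun c hc c' => ?_⟩
  set σ := Relation.Comp (opRel (some (Sum.inr (Sum.inl i)))) β with hσ
  have s0 : ∀ c d, c i = 0 → ¬ σ c d := by
    rintro c d hc ⟨e, h1, -⟩
    have := h1.1
    omega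
  have s1 : ∀ c d, P c → 0 < c i → (σ c d ↔ d = B (Function.update c i (c i - 1))) := by
    intro c d hc hi
    constructor
    · rintro ⟨e, ⟨-, rfl⟩, h⟩
      exact (k2 _ (h1 c hc hi) _).1 h
    · rintro rfl
      exact ⟨_, ⟨hi, rfl⟩, (k2 _ (h1 c hc hi) _).2 rfl⟩
  have key : ∀ n c, P c → c i = n → ∀ c', (∃ d, ReflTransGen σ c d ∧ d i = 0 ∧ c' = d) ↔ c' = h c := by
    intro n
    induction n with
    | zero =>
      intro c hc hn c'
      rw [h5 c hc hn]
      constructor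
      · rintro ⟨d, hd, -, rfl⟩
        rcases ReflTransGen.cases_head hd with e | ⟨e, he, -⟩
        · exact e.symm
        · exact absurd he (s0 _ _ hn)
      · rintro rfl
        exact ⟨_, .refl, hn, rfl⟩
    | succ n ih =>
      intro c hc hn c'
      have ih' := ih _ (h2 c hc (by omega)) (by rw [h3 c hc (by omega)]; omega) c'
      rw [h4 c hc (by omega)] at ih'
      rw [← ih']
      constructor
      · rintro ⟨d, hd, hd0, rfl⟩
        rcases ReflTransGen.cases_head hd with e | ⟨e, he, hd'⟩
        · subst e; omega
        · rw [s1 c e hc (by omega)] at he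
          subst he
          exact ⟨_, hd', hd0, rfl⟩
      · rintro ⟨d, hd, hd0, rfl⟩
        exact ⟨_, .head ((s1 c _ hc (by omega)).2 rfl) hd, hd0, rfl⟩
  exact key _ c hc rfl c'

theorem CF.clear (i : ℕ) : CF (fun _ => True) (fun c => Function.update c i 0) := by
  refine CF.loop i CF.skip (by simp) (by simp) (by simp) ?_ ?_
  · intro c _ _; simp
  · intro c _ h; rw [← h]; simp

theorem CF.copy {i o t : ℕ} (h1 : i ≠ o) (h2 : i ≠ t) (h3 : o ≠ t) :
    CF (fun c => c t = 0) (fun c => Function.update c o (c i)) := by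
  have A : CF (fun _ => True) (fun c => Function.update (Function.update (Function.update c i 0) o (c o + c i)) t (c t + c i)) := by
    refine CF.loop i (((CF.inc o).seq (CF.inc t) (by simp))) (by simp) (by simp) ?_ ?_ ?_
    · intro c _ _
      simp [Function.update_apply, h1, h2]
    · intro c _ h
      funext z
      simp only [Function.update_apply, h1, h2, h3, h1.symm, h2.symm, h3.symm, if_true, if_false]
      split_ifs <;> first | rfl | omega
    · intro c _ h
      funext z
      simp only [Function.update_apply, h]
      split_ifs <;> simp_all
  have B : CF (fun _ => True) (fun c => Function.update (Function.update c t 0) i (c i + c t)) := by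
    refine CF.loop t (CF.inc i) (by simp) (by simp) ?_ ?_ ?_
    · intro c _ _
      simp [Function.update_apply, h2.symm]
    · intro c _ h
      funext z
      simp only [Function.update_apply, h1, h2, h3, h1.symm, h2.symm, h3.symm, if_true, if_false]
      split_ifs <;> first | rfl | omega
    · intro c _ h
      funext z
      simp only [Function.update_apply, h]
      split_ifs <;> simp_all
  refine (((CF.clear o).seq A (by simp)).seq B (by simp)).congr (by simp) ?_
  intro c hc
  funext z
  simp only [Function.update_apply, h1, h2, h3, h1.symm, h2.symm, h3.symm, if_true, if_false]
  split_ifs <;> simp_all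

/-- all registers from `s` on are zero -/
def Pz (s : ℕ) (c : ℕ → ℕ) : Prop := ∀ z, s ≤ z → c z = 0

def CompF {n : ℕ} (f : List.Vector ℕ n → ℕ) : Prop :=
  ∀ (r : Fin n → ℕ) (o s : ℕ), (∀ j, r j < s) → o < s → (∀ j, r j ≠ o) →
    CF (Pz s) (fun c => Function.update c o (f (List.Vector.ofFn fun j => c (r j))))

theorem CompF.zero : CompF (n := 0) (fun _ => 0) := by
  intro r o s _ _ _
  exact (CF.clear o).congr (by simp) (by simp)

theorem CompF.get {n} (i : Fin n) : CompF (fun v => v.get i) := by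
  intro r o s h1 h2 h3
  refine (CF.copy (i := r i) (o := o) (t := s) (h3 i) (h1 i).ne h2.ne).congr ?_ ?_
  · intro c hc; exact hc s le_rfl
  · intro c hc; simp

theorem CompF.succ : CompF (n := 1) (fun v => Nat.succ v.head) := by
  intro r o s h1 h2 h3
  refine ((CF.copy (i := r 0) (o := o) (t := s) (h3 0) (h1 0).ne h2.ne).seq (CF.inc o) (by simp)).congr ?_ ?_
  · intro c hc; exact hc s le_rfl
  · intro c hc; simp

theorem CompF.comp {m n} {f : List.Vector ℕ n → ℕ} (g : Fin n → List.Vector ℕ m → ℕ)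
    (hf : CompF f) (hg : ∀ i, CompF (g i)) :
    CompF (fun a => f (List.Vector.ofFn fun i => g i a)) := by
  intro r o s h1 h2 h3
  have A : ∀ k, (hk : k ≤ n) → CF (Pz s) (fun c z => if h : s ≤ z ∧ z < s + k then
      g ⟨z - s, by omega⟩ (List.Vector.ofFn fun j => c (r j)) else c z) := by
    intro k
    induction k with
    | zero =>
      intro _
      refine CF.skip.congr (by simp) ?_
      intro c _; funext z
      rw [dif_neg (by omega)]
    | succ k ih =>
      intro hk
      refine ((ih (by omega)).seq (hg ⟨k, by omega⟩ r (s+k) (s+n) (fun j => by have := h1 j; omega) (by omega)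
        (fun j => by have := h1 j; omega)) ?_).congr (fun _ h => h) ?_
      · intro c hc z hz
        beta_reduce
        rw [dif_neg (by omega)]
        exact hc z (by omega)
      · intro c hc
        funext z
        simp only [Function.update_apply]
        by_cases hz : z = s + k
        · subst hz
          rw [if_pos rfl, dif_pos (by omega)]
          simp only [Nat.add_sub_cancel_left]
          congr 2
          funext j
          rw [dif_neg (by have := h1 j; omega)]
        · rw [if_neg hz]
          by_cases hz2 : s ≤ z ∧ z < s + k
          · rw [dif_pos hz2, dif_pos (by omega)]
          · rw [dif_neg hz2, dif_neg (by omega)]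
  have C : ∀ k, CF (fun _ => True) (fun c z => if s ≤ z ∧ z < s + k then 0 else c z) := by
    intro k
    induction k with
    | zero =>
      refine CF.skip.congr (by simp) ?_
      intro c _; funext z
      rw [if_neg (by omega)]
    | succ k ih =>
      refine (ih.seq (CF.clear (s+k)) (by simp)).congr (by simp) ?_
      intro c _; funext z
      simp only [Function.update_apply]
      split_ifs <;> first | rfl | omega
  refine (((A n le_rfl).seq (hf (fun j => s + j) o (s+n) (by simp) (by omega) (by intro j; omega)) ?_).seq
    (C n) (by simp)).congr (fun _ h => h) ?_
  · intro c hc z hz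
    beta_reduce
    rw [dif_neg (by omega)]
    exact hc z (by omega)
  · intro c hc
    funext z
    simp only [Function.update_apply]
    by_cases hz : s ≤ z ∧ z < s + n
    · rw [if_pos hz, if_neg (by omega), hc z (by omega)]
    · rw [if_neg hz]
      by_cases ho : z = o
      · subst ho
        rw [if_pos rfl, if_pos rfl]
        congr 2
        funext j
        rw [dif_pos (by omega)]
        simp
      · rw [if_neg ho, if_neg ho, dif_neg hz]

section prec
variable {n : ℕ} (g : List.Vector ℕ (n+2) → ℕ) (v : List.Vector ℕ n)

def precW : ℕ → ℕ → ℕ → ℕ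
  | 0, _, ih => ih
  | k+1, y, ih => precW k (y+1) (g (y ::ᵥ ih ::ᵥ v))

theorem precW_eq (a : ℕ) (k y : ℕ) :
    precW g v k y (Nat.rec a (fun y ih => g (y ::ᵥ ih ::ᵥ v)) y) =
      Nat.rec a (fun y ih => g (y ::ᵥ ih ::ᵥ v)) (y+k) := by
  induction k generalizing y with
  | zero => rfl
  | succ k ih =>
    simp only [precW]
    have := ih (y+1)
    rw [show y + (k+1) = y + 1 + k by omega, ← this]
end prec

theorem CompF.prec {n} {f : List.Vector ℕ n → ℕ} {g : List.Vector ℕ (n+2) → ℕ}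
    (hf : CompF f) (hg : CompF g) :
    CompF (fun v : List.Vector ℕ (n+1) =>
      v.head.rec (f v.tail) fun y ih => g (y ::ᵥ ih ::ᵥ v.tail)) := by
  intro r o s h1 h2 h3
  have hr : ∀ j, r j ≠ s ∧ r j ≠ s+1 ∧ r j ≠ s+2 ∧ r j ≠ s+3 ∧ r j ≠ s+4 ∧ r j < s + 5 := by
    intro j; have := h1 j; omega
  -- loop body
  have B0 := (hg (Fin.cons s (Fin.cons (s+1) fun j => r j.succ)) (s+2) (s+5) (by
      intro j; refine Fin.cases ?_ (fun j => Fin.cases ?_ (fun j => ?_) j) j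
      · simp
      · simp
      · simp; have := hr j.succ; omega) (by omega) (by
      intro j; refine Fin.cases ?_ (fun j => Fin.cases ?_ (fun j => ?_) j) j
      · simp
      · simp
      · simp; have := hr j.succ; omega)).congr (P' := Pz (s+4)) (fun c hc z hz => hc z (by omega))
        (fun _ _ => rfl)
  have B : CF (fun c => Pz (s+4) c) (fun c => Function.update (Function.update (Function.update c
      (s+1) (g (c s ::ᵥ c (s+1) ::ᵥ List.Vector.ofFn fun j => c (r j.succ)))) s (c s + 1)) (s+2) 0) := by
    refine (((B0.seq
      (CF.copy (i := s+2) (o := s+1) (t := s+4) (by omega) (by omega) (by omega)) ?_).seq (CF.clear (s+2))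
      (by simp)).seq (CF.inc s) (by simp)).congr (fun _ h => h) ?_
    · intro c hc
      rw [Function.update_of_ne (by omega)]
      exact hc _ (by omega)
    · intro c hc
      funext z
      have e : (List.Vector.ofFn fun j => c ((Fin.cons s (Fin.cons (s+1) fun j => r j.succ) : Fin (n+2) → ℕ) j)) = 
        (c s ::ᵥ c (s+1) ::ᵥ List.Vector.ofFn fun j => c (r j.succ)) := by
        simp [List.Vector.ofFn]
      simp only [e, Function.update_apply]
      split_ifs <;> first | rfl | omega | simp_all
  have L : CF (fun c => Pz (s+4) c ∧ c (s+2) = 0) (fun c => Function.update (Function.update (Function.update c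
      (s+1) (precW g (List.Vector.ofFn fun j => c (r j.succ)) (c (s+3)) (c s) (c (s+1)))) s (c s + c (s+3))) (s+3) 0) := by
    refine CF.loop (s+3) B ?_ ?_ ?_ ?_ ?_
    · intro c hc _ z hz
      rw [Function.update_of_ne (by omega)]; exact hc.1 z hz
    · intro c hc _ 
      refine ⟨fun z hz => ?_, by simp⟩
      simp only [Function.update_apply]
      have := hc.1 z hz
      split_ifs <;> first | rfl | omega
    · intro c hc _
      simp [Function.update_apply]
    · rintro c ⟨hc, hc2⟩ h
      obtain ⟨k, hk⟩ : ∃ k, c (s+3) = k + 1 := ⟨c (s+3) - 1, by omega⟩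
      have q : ∀ j, r j ≠ s ∧ r j ≠ s+1 ∧ r j ≠ s+2 ∧ r j ≠ s+3 := fun j => by
        have := hr j; omega
      funext z
      simp only [Function.update_apply, (q _).1, (q _).2.1, (q _).2.2.1, (q _).2.2.2, if_false, hk,
        Nat.add_sub_cancel, precW]
      have z2 : z = s + 2 → c z = 0 := by rintro rfl; exact hc2
      split_ifs <;> first | rfl | omega | skip
      all_goals simp_all
      all_goals first | rfl | omega
    · rintro c ⟨hc, hc2⟩ h
      funext z
      simp only [Function.update_apply, h, precW]
      split_ifs <;> simp_all
  have A0 := (hf (fun j => r j.succ) (s+1) (s+5) (fun j => by have := hr j.succ; omega) (by omega)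
    (fun j => by have := hr j.succ; omega)).congr (P' := Pz s) (fun c hc z hz => hc z (by omega))
        (fun _ _ => rfl)
  have A1 := A0.seq (CF.copy (i := r 0) (o := s+3) (t := s+4) (by have := hr 0; omega)
    (by have := hr 0; omega) (by omega)) (by
      intro c hc
      rw [Function.update_of_ne (by omega)]
      exact hc _ (by omega))
  have A2 := A1.seq L (by
    intro c hc
    refine ⟨fun z hz => ?_, ?_⟩
    · rw [Function.update_of_ne (by omega), Function.update_of_ne (by omega)]
      exact hc _ (by omega)
    · rw [Function.update_of_ne (by omega), Function.update_of_ne (by omega)]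
      exact hc _ (by omega))
  have A3 := A2.seq (CF.copy (i := s+1) (o := o) (t := s+4) (by omega) (by omega) (by omega)) (by
    intro c hc
    rw [Function.update_of_ne (by omega), Function.update_of_ne (by omega), Function.update_of_ne (by omega),
      Function.update_of_ne (by omega), Function.update_of_ne (by omega)]
    exact hc _ (by omega))
  refine ((A3.seq (CF.clear s) (by simp)).seq (CF.clear (s+1)) (by simp)).congr (fun _ h => h) ?_
  intro c hc
  have q : ∀ j, r j ≠ s ∧ r j ≠ s+1 ∧ r j ≠ s+2 ∧ r j ≠ s+3 := fun j => by
    have := hr j; omega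
  have w := precW_eq g (List.Vector.ofFn fun j => c (r j.succ)) (f (List.Vector.ofFn fun j => c (r j.succ)))
    (c (r 0)) 0
  simp only [Nat.zero_add] at w
  have c0 := hc s le_rfl
  have c1 := hc (s+1) (by omega)
  have c3 := hc (s+3) (by omega)
  have oS : s ≠ o := by omega
  have oS1 : s + 1 ≠ o := by omega
  have oS2 : s + 3 ≠ o := by omega
  have z0 : s ≠ s + 1 := by omega
  have z1 : s ≠ s + 3 := by omega
  have z2 : s + 1 ≠ s + 3 := by omega
  funext z
  simp only [Function.update_apply, (q _).1, (q _).2.1, (q _).2.2.1, (q _).2.2.2, if_false, if_true, 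
    List.Vector.head_ofFn, List.Vector.tail_ofFn, c0, ← w, oS, oS1, oS2, z0, z1, z2, z0.symm, z1.symm, z2.symm]
  by_cases y0 : z = s
  · subst y0; simp [oS, c0]
  by_cases y1 : z = s + 1
  · subst y1; simp [oS1, c1]
  by_cases y2 : z = o
  · subst y2; simp [y0, y1]
  by_cases y3 : z = s + 3
  · subst y3; simp [y2, c3]
  simp [y0, y1, y2, y3]

theorem CompF_of_primrec {n} {f : List.Vector ℕ n → ℕ} (h : Nat.Primrec' f) : CompF f := by
  induction h with
  | zero => exact CompF.zero
  | succ => exact CompF.succ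
  | get i => exact CompF.get i
  | comp g _ _ ih1 ih2 => exact CompF.comp g ih1 ih2
  | prec _ _ ih1 ih2 => exact CompF.prec ih1 ih2
end

section
open Relation

/-! ## Part E: `Σ₁¹`-hardness of counter machine recurrence -/

def updZ (a : ℕ) : ℕ → ℕ := Function.update (fun _ => 0) 0 a

theorem incStar (c d : ℕ → ℕ) : ReflTransGen (opRel (some (Sum.inl 1))) c d ↔
    ∃ y, d = Function.update c 1 (c 1 + y) := by
  constructor
  · intro h
    induction h with
    | refl => exact ⟨0, by simp⟩
    | tail _ h ih =>
      obtain ⟨y, rfl⟩ := ih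
      simp only [opRel] at h
      subst h
      exact ⟨y+1, by simp [add_assoc]⟩
  · rintro ⟨y, rfl⟩
    induction y with
    | zero => simp; exact .refl
    | succ y ih =>
      refine ih.tail ?_
      simp [opRel, add_assoc]

theorem body_compilable (G : ℕ → ℕ → ℕ) (hG : Primrec₂ G) :
    ∃ ρ, Compilable ρ ∧ ∀ a c', ρ (updZ a) c' ↔ ∃ b y, G a y = b + 1 ∧ c' = updZ b := by
  have h1 := CompF_of_primrec (Nat.Primrec'.prim_iff₂.2 hG)
  obtain ⟨σ₁, k1, k2⟩ := h1 (fun j => j) 2 3 (fun j => by omega) (by omega) (fun j => by omega)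
  obtain ⟨σ₂, l1, l2⟩ := ((CF.copy (i := 2) (o := 0) (t := 3) (by omega) (by omega) (by omega)).seq
    (CF.clear 2) (by simp)).seq (CF.clear 1) (by simp)
  refine ⟨_, (Compilable.op (some (Sum.inl 1))).star.seq
    (k1.seq ((Compilable.op (some (Sum.inr (Sum.inl 2)))).seq l1)), ?_⟩
  intro a c'
  have P3 : ∀ y, Pz 3 (Function.update (updZ a) 1 (updZ a 1 + y)) := by
    intro y z hz
    rw [Function.update_of_ne (by omega), updZ, Function.update_of_ne (by omega)]
  have e1 : ∀ y, (Function.update (updZ a) 1 (updZ a 1 + y)) = fun z => if z = 0 then a else if z = 1 then y else 0 := by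
    intro y
    funext z
    simp only [updZ, Function.update_apply]
    split_ifs <;> simp_all
  have e2 : ∀ y b, G a y = b + 1 → (Function.update (Function.update (Function.update (updZ a) 1 (updZ a 1 + y)) 2 (b+1)) 2 b)
     = fun z => if z = 0 then a else if z = 1 then y else if z = 2 then b else 0 := by
    intro y b h
    rw [e1]
    funext z
    simp only [Function.update_apply]
    split_ifs <;> simp_all
  have e3 : ∀ y b, (Function.update (Function.update (Function.update
     (fun z => if z = 0 then a else if z = 1 then y else if z = 2 then b else 0) 0 b) 2 0) 1 0) = updZ b := by
    intro y b
    funext z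
    simp only [updZ, Function.update_apply]
    split_ifs <;> simp_all
  have ev : ∀ y, (List.Vector.ofFn fun j : Fin 2 => (Function.update (updZ a) 1 (updZ a 1 + y)) j).head = a := by
    intro y; rw [e1]; simp
  have ev2 : ∀ y, (List.Vector.ofFn fun j : Fin 2 => (Function.update (updZ a) 1 (updZ a 1 + y)) j).tail.head = y := by
    intro y; rw [e1]; simp
  constructor
  · rintro ⟨d1, g1, d2, g2, d3, g3, g4⟩
    obtain ⟨y, rfl⟩ := (incStar _ _).1 g1
    rw [k2 _ (P3 y)] at g2
    beta_reduce at g2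
    rw [ev, ev2] at g2
    subst g2
    simp only [opRel, Function.update_self] at g3
    obtain ⟨g3, rfl⟩ := g3
    obtain ⟨b, hb⟩ : ∃ b, G a y = b + 1 := ⟨G a y - 1, by omega⟩
    rw [hb] at g4
    simp only [Nat.add_sub_cancel] at g4
    rw [e2 y b hb, l2 _ (by simp)] at g4
    simp only [if_true] at g4
    refine ⟨b, y, hb, ?_⟩
    rw [g4, ← e3 y b]
    simp
  · rintro ⟨b, y, hb, rfl⟩
    refine ⟨_, (incStar _ _).2 ⟨y, rfl⟩, _, (k2 _ (P3 y) _).2 rfl, 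
      fun z => if z = 0 then a else if z = 1 then y else if z = 2 then b else 0, ⟨?_, ?_⟩, ?_⟩
    · beta_reduce; rw [ev, ev2, hb]; simp
    · beta_reduce; rw [ev, ev2, hb, Function.update_self, Nat.add_sub_cancel, e2 y b hb]
    · rw [l2 _ (by simp), ← e3 y b]
      simp

theorem chain_le_CMRecur (G : ℕ → ℕ → ℕ) (hG : Primrec₂ G) :
    ∃ F : ℕ → CMDesc × ℕ × ℕ, Primrec F ∧ ∀ m, CMRecur (F m) ↔
      ∃ t : ℕ → ℕ, t 0 = m ∧ ∀ k, ∃ y, G (t k) y = t (k+1) + 1 := by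
  obtain ⟨ρ, h1, h2⟩ := body_compilable G hG
  obtain ⟨F, hF, H⟩ := compile_recur ρ h1
  refine ⟨F, hF, fun m => (H m).trans ?_⟩
  constructor
  · rintro ⟨s, s0, ss⟩
    have key : ∀ k, s k = updZ (s k 0) := by
      intro k
      cases k with
      | zero => rw [s0]; simp [updZ]
      | succ k =>
        have : ∃ a, s k = updZ a := by
          induction k with
          | zero => exact ⟨_, s0⟩
          | succ k ih =>
            obtain ⟨a, ha⟩ := ih
            have := ss k
            rw [ha, h2] at this
            obtain ⟨b, y, -, h⟩ := this
            exact ⟨b, h⟩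
        obtain ⟨a, ha⟩ := this
        have := ss k
        rw [ha, h2] at this
        obtain ⟨b, y, -, h⟩ := this
        rw [h]; simp [updZ]
    refine ⟨fun k => s k 0, by simp [s0], fun k => ?_⟩
    have := ss k
    rw [key k, h2] at this
    obtain ⟨b, y, h, h'⟩ := this
    refine ⟨y, ?_⟩
    simp only [h, h']; simp [updZ]
  · rintro ⟨t, t0, ts⟩
    refine ⟨fun k => updZ (t k), by simp only [t0]; rfl, fun k => ?_⟩
    obtain ⟨y, hy⟩ := ts k
    exact (h2 _ _).2 ⟨_, y, hy, rfl⟩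

def decNL (s : ℕ) : ℕ × List ℕ := (Encodable.decode (α := ℕ × List ℕ) s).getD (0, [])

theorem decNL_encode (a : ℕ × List ℕ) : decNL (Encodable.encode a) = a := by
  rw [decNL, Encodable.encodek]; rfl

theorem pr_decNL : Primrec decNL :=
  Primrec.option_getD.comp Primrec.decode (.const _)

open Nat.Partrec (Code) in
theorem Sigma11_le_CMRecur (B : ℕ → Prop) (hB : Sigma11 B) : ManyOneReducible B CMRecur := by
  obtain ⟨R, ⟨dR, hR⟩, hBR⟩ := hB
  obtain ⟨code, hcode⟩ := Nat.Partrec.Code.exists_code.1 hR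
  have hR' : ∀ a, R a ↔ ∃ k, Code.evaln k code (Encodable.encode a) = some 1 := by
    intro a
    have h1 : code.eval (Encodable.encode a) = Part.some (Encodable.encode (decide (R a))) := by
      rw [hcode]; beta_reduce; rw [Encodable.encodek]; simp
    constructor
    · intro h
      have : (1 : ℕ) ∈ code.eval (Encodable.encode a) := by
        rw [h1]; simp [h]
      obtain ⟨k, hk⟩ := Code.evaln_complete.1 this
      exact ⟨k, hk⟩
    · rintro ⟨k, hk⟩
      have : (1 : ℕ) ∈ code.eval (Encodable.encode a) := Code.evaln_complete.2 ⟨k, hk⟩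
      rw [h1] at this
      by_contra h
      simp [h] at this
  set G : ℕ → ℕ → ℕ := fun s y =>
    if Code.evaln y.unpair.2 code (Encodable.encode (decNL s)) = some 1 then
      Encodable.encode ((decNL s).1, (decNL s).2 ++ [y.unpair.1]) + 1 else 0 with hGdef
  have hd : Primrec fun x : ℕ × ℕ => decNL x.1 := pr_decNL.comp .fst
  have hG : Primrec₂ G := by
    refine Primrec.ite (Primrec.eq.comp ?_ (.const _)) (Primrec.succ.comp (Primrec.encode.comp
      (Primrec.pair (Primrec.fst.comp hd) (Primrec.list_concat.comp (Primrec.snd.comp hd) 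
        (Primrec.fst.comp (Primrec.unpair.comp .snd)))))) (.const 0)
    exact Code.primrec_evaln.comp (Primrec.pair (Primrec.pair 
      (Primrec.snd.comp (Primrec.unpair.comp .snd)) (.const code)) (Primrec.encode.comp hd))
  obtain ⟨F, hF, H⟩ := chain_le_CMRecur G hG
  refine ⟨fun n => F (Encodable.encode (n, ([] : List ℕ))), ?_, fun n => ?_⟩
  · exact (hF.comp (Primrec.encode.comp (Primrec.pair .id (.const _)))).to_comp
  · rw [hBR, H]
    constructor
    · rintro ⟨f, hf⟩
      refine ⟨fun k => Encodable.encode (n, (List.range k).map f), rfl, fun k => ?_⟩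
      obtain ⟨j, hj⟩ := (hR' _).1 (hf k)
      refine ⟨Nat.pair (f k) j, ?_⟩
      simp only [hGdef, Nat.unpair_pair, decNL_encode, hj, if_true]
      rw [List.range_succ, List.map_append]
      rfl
    · rintro ⟨t, t0, ts⟩
      choose y hy using ts
      have key : ∀ k, t k = Encodable.encode (n, (List.range k).map fun k => (y k).unpair.1) := by
        intro k
        induction k with
        | zero => exact t0
        | succ k ih =>
          have := hy k
          rw [ih] at this
          simp only [hGdef, decNL_encode] at this
          split_ifs at this
          · rw [List.range_succ, List.map_append]
            exact (Nat.succ_injective this).symm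
      refine ⟨fun k => (y k).unpair.1, fun m => (hR' _).2 ⟨(y m).unpair.2, ?_⟩⟩
      have := hy m
      rw [key m] at this
      simp only [hGdef, decNL_encode] at this
      split_ifs at this with h
      exact h
end

section
open BForm

/-! ## Part F: the satisfiability problem is `Σ₁¹` -/

/-- normal form lemma for `Σ₁¹` -/
theorem Sigma11_of (A : ℕ → Prop) (q : ℕ → List ℕ) (C : (ℕ × ℕ) × List ℕ → Prop)
    (hq : Primrec q) (hC : PrimrecPred C)
    (h : ∀ n, A n ↔ ∃ f : ℕ → ℕ, ∀ x, C ((n, x), (q x).map f)) : Sigma11 A := by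
  refine ⟨fun p => ∀ x ∈ List.range p.2.length, (∀ a ∈ q x, a < p.2.length) →
    C ((p.1, x), (q x).map fun a => p.2.getD a 0), ?_, ?_⟩
  · apply PrimrecPred.computablePred
    have hl : Primrec fun y : ℕ × (ℕ × List ℕ) => y.2.2.length :=
      Primrec.list_length.comp (Primrec.snd.comp .snd)
    have hqx : Primrec fun y : ℕ × (ℕ × List ℕ) => q y.1 := hq.comp .fst
    have h1 : PrimrecPred fun y : ℕ × (ℕ × List ℕ) => ∀ a ∈ q y.1, a < y.2.2.length :=
      (PrimrecRel.forall_mem_list Primrec.nat_lt).comp hqx hl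
    have hm : Primrec fun y : ℕ × (ℕ × List ℕ) => (q y.1).map fun a => y.2.2.getD a 0 := by
      refine Primrec.list_map hqx ?_
      exact (Primrec.list_getD 0).comp (Primrec.snd.comp (Primrec.snd.comp .fst)) .snd
    have h2 : PrimrecPred fun y : ℕ × (ℕ × List ℕ) =>
        C ((y.2.1, y.1), (q y.1).map fun a => y.2.2.getD a 0) :=
      hC.comp (Primrec.pair (Primrec.pair (Primrec.fst.comp .snd) .fst) hm)
    have h3 : PrimrecRel fun (x : ℕ) (p : ℕ × List ℕ) => (∀ a ∈ q x, a < p.2.length) →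
        C ((p.1, x), (q x).map fun a => p.2.getD a 0) :=
      (h1.not.or h2).of_eq fun y => by
        constructor
        · rintro (h | h) h'
          · exact absurd h' h
          · exact h
        · intro h
          by_cases h' : ∀ a ∈ q y.1, a < y.2.2.length
          · exact Or.inr (h h')
          · exact Or.inl h'
    exact (PrimrecRel.forall_mem_list h3).comp (Primrec.list_range.comp (Primrec.list_length.comp .snd)) .id
  · intro n
    rw [h]
    refine exists_congr fun f => ?_
    have e : ∀ m x, (∀ a ∈ q x, a < m) →
        ((q x).map fun a => ((List.range m).map f).getD a 0) = (q x).map f := by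
      intro m x hx
      apply List.map_congr_left
      intro a ha
      have := hx a ha
      simp [List.getD_eq_getElem?_getD, this]
    constructor
    · intro H m x hx hq'
      simp only [List.length_map, List.length_range] at hq' hx ⊢
      rw [e m x hq']
      exact H x
    · intro H x
      have hb : ∀ a ∈ q x, a < (q x).sum + x + 1 := by
        intro a ha
        have := List.single_le_sum (l := q x) (by simp) a ha
        omega
      have := H ((q x).sum + x + 1) x (by simp) (by simpa using hb)
      simp only at this
      rwa [e _ x hb] at this

/-- the local correctness clause -/
def Clause (n e t d w : ℕ) (v : ℕ → ℕ) : Prop :=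
  (e = n → v 0 ≠ 0) ∧ (e = n → v 12 = Nat.pair t d → v 4 ≠ 0 ∧ v 6 ≠ 0) ∧
  (v 0 ≠ 0 →
    (e.unpair.1 = 0 ∨ e.unpair.1 = 1 ∧ v 1 ≠ 0 ∨ e.unpair.1 = 2 ∧ v 2 ≠ 0 ∧ v 3 ≠ 0 ∨
      e.unpair.1 = 3 ∧ v 1 ≠ 0 ∨ e.unpair.1 = 4 ∧ v 1 ≠ 0) ∧
    (v 4 ≠ 0 →
      (e.unpair.1 = 1 → (v 6 = 0 ↔ v 7 ≠ 0)) ∧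
      (e.unpair.1 = 2 → (v 6 ≠ 0 ↔ v 8 ≠ 0 ∧ v 9 ≠ 0)) ∧
      (e.unpair.1 = 3 → (v 6 = w + 1 → t < w ∧ v 10 ≠ 0) ∧ (v 6 = 0 → t < w → v 10 = 0)) ∧
      (e.unpair.1 = 4 → (v 6 = w + 1 → v 5 ≠ 0 ∧ d ≠ w ∧ v 11 ≠ 0) ∧
        (v 6 = 0 → v 5 ≠ 0 → d ≠ w → v 11 = 0))))

def tPos (e t d : ℕ) : ℕ := Nat.pair 2 (Nat.pair e (Nat.pair t d))

def qsAt (e t d w : ℕ) : List ℕ :=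
  [Nat.pair 0 e, Nat.pair 0 e.unpair.2, Nat.pair 0 e.unpair.2.unpair.1, Nat.pair 0 e.unpair.2.unpair.2,
   Nat.pair 1 d, Nat.pair 1 w,
   tPos e t d, tPos e.unpair.2 t d, tPos e.unpair.2.unpair.1 t d, tPos e.unpair.2.unpair.2 t d,
   tPos e.unpair.2 w d, tPos e.unpair.2 t w, Nat.pair 3 0]

def xE (x : ℕ) : ℕ := x.unpair.1
def xT (x : ℕ) : ℕ := x.unpair.2.unpair.1
def xD (x : ℕ) : ℕ := x.unpair.2.unpair.2.unpair.1
def xW (x : ℕ) : ℕ := x.unpair.2.unpair.2.unpair.2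

section
variable {α : Type} [Primcodable α] {p q : α → Prop}
theorem pp_imp (hp : PrimrecPred p) (hq : PrimrecPred q) : PrimrecPred fun a => p a → q a :=
  (hp.not.or hq).of_eq fun a => by tauto
theorem pp_iff (hp : PrimrecPred p) (hq : PrimrecPred q) : PrimrecPred fun a => (p a ↔ q a) :=
  ((pp_imp hp hq).and (pp_imp hq hp)).of_eq fun a => by tauto
end

theorem pr_un1 : Primrec fun x : ℕ => x.unpair.1 := Primrec.fst.comp .unpair
theorem pr_un2 : Primrec fun x : ℕ => x.unpair.2 := Primrec.snd.comp .unpair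
theorem pr_xE : Primrec xE := pr_un1
theorem pr_xT : Primrec xT := pr_un1.comp pr_un2
theorem pr_xD : Primrec xD := pr_un1.comp (pr_un2.comp pr_un2)
theorem pr_xW : Primrec xW := pr_un2.comp (pr_un2.comp pr_un2)

theorem pr_qs : Primrec fun x => qsAt (xE x) (xT x) (xD x) (xW x) := by
  have hp : ∀ (k : ℕ) {g : ℕ → ℕ}, Primrec g → Primrec fun x => Nat.pair k (g x) :=
    fun k {g} h => Primrec₂.natPair.comp (.const k) h
  have ht : ∀ {g h k : ℕ → ℕ}, Primrec g → Primrec h → Primrec k →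
      Primrec fun x => tPos (g x) (h x) (k x) := fun {g h k} hg hh hk =>
    hp 2 (Primrec₂.natPair.comp hg (Primrec₂.natPair.comp hh hk))
  have ha := pr_un2.comp pr_xE
  have ha1 := pr_un1.comp ha
  have ha2 := pr_un2.comp ha
  have cons : ∀ {g : ℕ → ℕ} {L : ℕ → List ℕ}, Primrec g → Primrec L → Primrec fun x => g x :: L x :=
    fun hg hL => Primrec.list_cons.comp hg hL
  exact cons (hp 0 pr_xE) <| cons (hp 0 ha) <| cons (hp 0 ha1) <| cons (hp 0 ha2) <|
    cons (hp 1 pr_xD) <| cons (hp 1 pr_xW) <| cons (ht pr_xE pr_xT pr_xD) <|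
    cons (ht ha pr_xT pr_xD) <| cons (ht ha1 pr_xT pr_xD) <| cons (ht ha2 pr_xT pr_xD) <|
    cons (ht ha pr_xW pr_xD) <| cons (ht ha pr_xT pr_xW) <| cons (.const _) (.const [])

theorem pr_Clause : PrimrecPred fun y : (ℕ × ℕ) × List ℕ =>
    Clause y.1.1 (xE y.1.2) (xT y.1.2) (xD y.1.2) (xW y.1.2) (fun i => y.2.getD i 0) := by
  have v : ∀ i : ℕ, Primrec fun y : (ℕ × ℕ) × List ℕ => y.2.getD i 0 := fun i =>
    (Primrec.list_getD 0).comp .snd (.const i)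
  have hn : Primrec fun y : (ℕ × ℕ) × List ℕ => y.1.1 := Primrec.fst.comp .fst
  have hx : Primrec fun y : (ℕ × ℕ) × List ℕ => y.1.2 := Primrec.snd.comp .fst
  have hE := pr_xE.comp hx
  have hT := pr_xT.comp hx
  have hD := pr_xD.comp hx
  have hW := pr_xW.comp hx
  have z : ∀ i : ℕ, PrimrecPred fun y : (ℕ × ℕ) × List ℕ => y.2.getD i 0 = 0 :=
    fun i => Primrec.eq.comp (v i) (.const 0)
  have nz : ∀ i : ℕ, PrimrecPred fun y : (ℕ × ℕ) × List ℕ => y.2.getD i 0 ≠ 0 := fun i => (z i).not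
  have tg : ∀ i : ℕ, PrimrecPred fun y : (ℕ × ℕ) × List ℕ => (xE y.1.2).unpair.1 = i :=
    fun i => Primrec.eq.comp (pr_un1.comp hE) (.const i)
  have en : PrimrecPred fun y : (ℕ × ℕ) × List ℕ => xE y.1.2 = y.1.1 := Primrec.eq.comp hE hn
  have dw : PrimrecPred fun y : (ℕ × ℕ) × List ℕ => xD y.1.2 ≠ xW y.1.2 := (Primrec.eq.comp hD hW).not
  have tw : PrimrecPred fun y : (ℕ × ℕ) × List ℕ => xT y.1.2 < xW y.1.2 := Primrec.nat_lt.comp hT hW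
  have six : PrimrecPred fun y : (ℕ × ℕ) × List ℕ => y.2.getD 6 0 = xW y.1.2 + 1 :=
    Primrec.eq.comp (v 6) (Primrec.succ.comp hW)
  have ini : PrimrecPred fun y : (ℕ × ℕ) × List ℕ => y.2.getD 12 0 = Nat.pair (xT y.1.2) (xD y.1.2) :=
    Primrec.eq.comp (v 12) (Primrec₂.natPair.comp hT hD)
  exact (pp_imp en (nz 0)).and <| (pp_imp en (pp_imp ini ((nz 4).and (nz 6)))).and <|
    pp_imp (nz 0) <| ((tg 0).or <| ((tg 1).and (nz 1)).or <| ((tg 2).and ((nz 2).and (nz 3))).or <|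
      ((tg 3).and (nz 1)).or ((tg 4).and (nz 1))).and <| pp_imp (nz 4) <|
      (pp_imp (tg 1) (pp_iff (z 6) (nz 7))).and <|
      (pp_imp (tg 2) (pp_iff (nz 6) ((nz 8).and (nz 9)))).and <|
      (pp_imp (tg 3) ((pp_imp six (tw.and (nz 10))).and (pp_imp (z 6) (pp_imp tw (z 10))))).and <|
      (pp_imp (tg 4) ((pp_imp six ((nz 5).and (dw.and (nz 11)))).and
        (pp_imp (z 6) (pp_imp (nz 5) (pp_imp dw (z 11))))))

/-- global correctness of a coded model -/
def GoodF (n : ℕ) (f : ℕ → ℕ) : Prop :=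
  ∀ e t d w, Clause n e t d w (fun i => ((qsAt e t d w).map f).getD i 0)

theorem Sigma11_GoodF : Sigma11 (fun n => ∃ f, GoodF n f) := by
  refine Sigma11_of _ _ _ pr_qs pr_Clause fun n => exists_congr fun f => ?_
  constructor
  · intro h x; exact h _ _ _ _
  · intro h e t d w
    have := h (Nat.pair e (Nat.pair t (Nat.pair d w)))
    simpa [xE, xT, xD, xW] using this
end

section
open BForm

/-- the local clause in terms of the components of the coded model -/
def Clause2 (n e t d w : ℕ) (V E : ℕ → ℕ) (T : ℕ → ℕ → ℕ → ℕ) (s : ℕ) : Prop :=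
  (e = n → V e ≠ 0) ∧ (e = n → s = Nat.pair t d → E d ≠ 0 ∧ T e t d ≠ 0) ∧
  (V e ≠ 0 →
    (e.unpair.1 = 0 ∨ e.unpair.1 = 1 ∧ V e.unpair.2 ≠ 0 ∨
      e.unpair.1 = 2 ∧ V e.unpair.2.unpair.1 ≠ 0 ∧ V e.unpair.2.unpair.2 ≠ 0 ∨
      e.unpair.1 = 3 ∧ V e.unpair.2 ≠ 0 ∨ e.unpair.1 = 4 ∧ V e.unpair.2 ≠ 0) ∧
    (E d ≠ 0 →
      (e.unpair.1 = 1 → (T e t d = 0 ↔ T e.unpair.2 t d ≠ 0)) ∧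
      (e.unpair.1 = 2 → (T e t d ≠ 0 ↔
        T e.unpair.2.unpair.1 t d ≠ 0 ∧ T e.unpair.2.unpair.2 t d ≠ 0)) ∧
      (e.unpair.1 = 3 → (T e t d = w + 1 → t < w ∧ T e.unpair.2 w d ≠ 0) ∧
        (T e t d = 0 → t < w → T e.unpair.2 w d = 0)) ∧
      (e.unpair.1 = 4 → (T e t d = w + 1 → E w ≠ 0 ∧ d ≠ w ∧ T e.unpair.2 t w ≠ 0) ∧
        (T e t d = 0 → E w ≠ 0 → d ≠ w → T e.unpair.2 t w = 0))))

theorem GoodF_iff (n : ℕ) (f : ℕ → ℕ) : GoodF n f ↔ ∀ e t d w, Clause2 n e t d w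
    (fun e => f (Nat.pair 0 e)) (fun d => f (Nat.pair 1 d)) (fun e t d => f (tPos e t d))
    (f (Nat.pair 3 0)) := Iff.rfl

theorem sat_of_good (n : ℕ) (V E : ℕ → ℕ) (T : ℕ → ℕ → ℕ → ℕ) (s : ℕ)
    (H : ∀ e t d w, Clause2 n e t d w V E T s) : BCodes OmegaDiffSat n := by
  let D : Type := {d : ℕ // E d ≠ 0}
  let val : ℕ → ℕ × D → Prop := fun k p => T (Nat.pair 0 k) p.1 p.2.1 ≠ 0
  have key : ∀ e, V e ≠ 0 → ∃ φ, encodeB φ = e ∧ ∀ t (d : D), T e t d.1 ≠ 0 ↔ PS val t d φ := by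
    intro e
    induction e using Nat.strong_induction_on with
    | _ e ih =>
      intro hV
      have hp : Nat.pair e.unpair.1 e.unpair.2 = e := Nat.pair_unpair e
      have hle := Nat.add_le_pair e.unpair.1 e.unpair.2
      rw [hp] at hle
      have hl1 := Nat.unpair_left_le e.unpair.2
      have hl2 := Nat.unpair_right_le e.unpair.2
      have HH := fun t (d : D) w => ((H e t d.1 w).2.2 hV).2 d.2
      rcases ((H e 0 0 0).2.2 hV).1 with h | ⟨h, ha⟩ | ⟨h, ha, hb⟩ | ⟨h, ha⟩ | ⟨h, ha⟩
      · refine ⟨var e.unpair.2, ?_, fun t d => ?_⟩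
        · rw [encodeB, ← h, hp]
        · rw [PS_var]
          show _ ↔ T (Nat.pair 0 e.unpair.2) t d.1 ≠ 0
          have h3 : Nat.pair 0 e.unpair.2 = e := by rw [← h, hp]
          rw [h3]
      · obtain ⟨φ, h1, h2⟩ := ih _ (by omega) ha
        refine ⟨neg φ, ?_, fun t d => ?_⟩
        · rw [encodeB, h1, ← h, hp]
        · rw [PS_neg, ← h2, not_iff_not]
          exact iff_not_comm.mp (by have := (HH t d 0).1 h; tauto)
      · obtain ⟨φ, h1, h2⟩ := ih _ (by omega) ha
        obtain ⟨ψ, h3, h4⟩ := ih _ (by omega) hb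
        refine ⟨and φ ψ, ?_, fun t d => ?_⟩
        · rw [encodeB, h1, h3, Nat.pair_unpair, ← h, hp]
        · rw [PS_and, ← h2, ← h4]
          exact (HH t d 0).2.1 h
      · obtain ⟨φ, h1, h2⟩ := ih _ (by omega) ha
        refine ⟨dia0 φ, ?_, fun t d => ?_⟩
        · rw [encodeB, h1, ← h, hp]
        · rw [PS_dia0]
          constructor
          · intro h5
            obtain ⟨w, hw⟩ := Nat.exists_eq_succ_of_ne_zero h5
            obtain ⟨h6, h7⟩ := ((HH t d w).2.2.1 h).1 hw
            exact ⟨w, h6, (h2 _ _).1 h7⟩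
          · rintro ⟨w, h6, h7⟩ h8
            exact (h2 _ _).2 h7 (((HH t d w).2.2.1 h).2 h8 h6)
      · obtain ⟨φ, h1, h2⟩ := ih _ (by omega) ha
        refine ⟨dia1 φ, ?_, fun t d => ?_⟩
        · rw [encodeB, h1, ← h, hp]
        · rw [PS_dia1]
          constructor
          · intro h5
            obtain ⟨w, hw⟩ := Nat.exists_eq_succ_of_ne_zero h5
            obtain ⟨h6, h7, h8⟩ := ((HH t d w).2.2.2 h).1 hw
            exact ⟨⟨w, h6⟩, fun hc => h7 (congrArg Subtype.val hc), (h2 t ⟨w, h6⟩).1 h8⟩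
          · rintro ⟨w, h6, h7⟩ h8
            exact (h2 _ _).2 h7 (((HH t d w.1).2.2.2 h).2 h8 w.2 fun hc => h6 (Subtype.ext hc))
  have h0 := (H n 0 0 0).1 rfl
  obtain ⟨φ, h1, h2⟩ := key n h0
  obtain ⟨hE, hT⟩ := (H n s.unpair.1 s.unpair.2 0).2.1 rfl (Nat.pair_unpair s).symm
  exact ⟨φ, h1, D, ⟨⟨_, hE⟩⟩, val, (s.unpair.1, ⟨s.unpair.2, hE⟩), (h2 s.unpair.1 ⟨_, hE⟩).1 hT⟩

theorem exists_two_witnesses {W : Type} (d0 : W) (P : W → Prop) :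
    ∃ p : W × W, ∀ d, (∃ e, d ≠ e ∧ P e) → (d ≠ p.1 ∧ P p.1) ∨ (d ≠ p.2 ∧ P p.2) := by
  by_cases h : ∃ a b, a ≠ b ∧ P a ∧ P b
  · obtain ⟨a, b, hab, ha, hb⟩ := h
    refine ⟨(a, b), fun d _ => ?_⟩
    by_cases hd : d = a
    · exact Or.inr ⟨fun hc => hab (hd.symm.trans hc), hb⟩
    · exact Or.inl ⟨hd, ha⟩
  · by_cases h1 : ∃ a, P a
    · obtain ⟨a, ha⟩ := h1
      refine ⟨(a, a), ?_⟩
      rintro d ⟨e, hde, he⟩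
      have : e = a := by
        by_contra hc
        exact h ⟨e, a, hc, he, ha⟩
      subst this
      exact Or.inl ⟨hde, he⟩
    · exact ⟨(d0, d0), fun d ⟨e, _, he⟩ => absurd ⟨e, he⟩ h1⟩

theorem good_of_sat (n : ℕ) (h : BCodes OmegaDiffSat n) :
    ∃ (V E : ℕ → ℕ) (T : ℕ → ℕ → ℕ → ℕ) (s : ℕ), ∀ e t d w, Clause2 n e t d w V E T s := by
  classical
  obtain ⟨φ0, rfl, W, -, val, ⟨t0, d0⟩, hsat⟩ := h
  change PS val t0 d0 φ0 at hsat
  have : Countable BForm := encodeB_inj.countable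
  choose wit hwit using fun p : ℕ × BForm => exists_two_witnesses d0 (fun e => PS val p.1 e p.2)
  let S : Set W := {d0} ∪ (Set.range (fun p => (wit p).1) ∪ Set.range (fun p => (wit p).2))
  have hS : S.Countable :=
    (Set.countable_singleton _).union ((Set.countable_range _).union (Set.countable_range _))
  have h1 : ∀ p, (wit p).1 ∈ S := fun p => Or.inr (Or.inl ⟨p, rfl⟩)
  have h2 : ∀ p, (wit p).2 ∈ S := fun p => Or.inr (Or.inr ⟨p, rfl⟩)
  have : Countable S := hS.to_subtype
  obtain ⟨ι, hι⟩ := exists_injective_nat S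
  have hd1 : ∀ t (d : S) ψ, PS val t d.1 (dia1 ψ) ↔ ∃ e : S, d ≠ e ∧ PS val t e.1 ψ := by
    intro t d ψ
    rw [PS_dia1]
    constructor
    · intro h
      rcases hwit (t, ψ) d.1 h with ⟨ha, hb⟩ | ⟨ha, hb⟩
      · exact ⟨⟨_, h1 (t, ψ)⟩, fun hc => ha (congrArg Subtype.val hc), hb⟩
      · exact ⟨⟨_, h2 (t, ψ)⟩, fun hc => ha (congrArg Subtype.val hc), hb⟩
    · rintro ⟨e, he, h⟩
      exact ⟨e.1, fun hc => he (Subtype.ext hc), h⟩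
  have hTT : ∀ (φ : BForm) (t : ℕ) (d : S), ∃ v : ℕ, (v ≠ 0 ↔ PS val t d.1 φ) ∧
      (∀ ψ w, φ = dia0 ψ → v = w + 1 → t < w ∧ PS val w d.1 ψ) ∧
      (∀ ψ w, φ = dia1 ψ → v = w + 1 → ∃ d' : S, ι d' = w ∧ d ≠ d' ∧ PS val t d'.1 ψ) := by
    intro φ t d
    by_cases hφ : PS val t d.1 φ
    · cases φ with
      | dia0 ψ =>
        obtain ⟨u, hu, hu'⟩ := (PS_dia0 val t d.1 ψ).1 hφ
        refine ⟨u + 1, by simp [hφ], ?_, by simp⟩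
        rintro ψ' w hψ hw
        cases hψ
        cases hw
        exact ⟨hu, hu'⟩
      | dia1 ψ =>
        obtain ⟨u, hu, hu'⟩ := (hd1 t d ψ).1 hφ
        refine ⟨ι u + 1, by simp [hφ], by simp, ?_⟩
        rintro ψ' w hψ hw
        cases hψ
        cases hw
        exact ⟨u, rfl, hu, hu'⟩
      | var _ => exact ⟨1, by simp [hφ], by simp, by simp⟩
      | neg _ => exact ⟨1, by simp [hφ], by simp, by simp⟩
      | and _ _ => exact ⟨1, by simp [hφ], by simp, by simp⟩
    · exact ⟨0, by simp [hφ], by simp, by simp⟩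
  choose TT hT0 hT3 hT4 using hTT
  let T : ℕ → ℕ → ℕ → ℕ := fun e t k =>
    if h : ∃ (φ : BForm) (d : S), encodeB φ = e ∧ ι d = k then TT h.choose t h.choose_spec.choose
    else 0
  have hT : ∀ φ t d, T (encodeB φ) t (ι d) = TT φ t d := by
    intro φ t d
    have hex : ∃ (φ' : BForm) (d' : S), encodeB φ' = encodeB φ ∧ ι d' = ι d := ⟨φ, d, rfl, rfl⟩
    have hh := hex.choose_spec.choose_spec
    show (if h : ∃ (φ' : BForm) (d' : S), encodeB φ' = encodeB φ ∧ ι d' = ι d then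
      TT h.choose t h.choose_spec.choose else 0) = _
    rw [dif_pos hex, hι hh.2, encodeB_inj hh.1]
  have hTn : ∀ φ t d, T (encodeB φ) t (ι d) ≠ 0 ↔ PS val t d.1 φ := by
    intro φ t d
    rw [hT]; exact hT0 φ t d
  have hTz : ∀ φ t d, T (encodeB φ) t (ι d) = 0 ↔ ¬ PS val t d.1 φ := by
    intro φ t d
    rw [← hTn, not_not]
  let V : ℕ → ℕ := fun e => if ∃ φ, encodeB φ = e then 1 else 0
  let E : ℕ → ℕ := fun k => if ∃ d : S, ι d = k then 1 else 0
  have hV : ∀ e, V e ≠ 0 ↔ ∃ φ, encodeB φ = e := by intro e; simp [V]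
  have hE : ∀ e, E e ≠ 0 ↔ ∃ d, ι d = e := by intro e; simp [E]
  have hVφ : ∀ φ, V (encodeB φ) ≠ 0 := fun φ => (hV _).2 ⟨φ, rfl⟩
  let d0' : S := ⟨d0, Or.inl rfl⟩
  refine ⟨V, E, T, Nat.pair t0 (ι d0'), ?_⟩
  clear_value V E T
  intro e t d w
  refine ⟨?_, ?_, ?_⟩
  · rintro rfl
    exact hVφ φ0
  · rintro rfl he
    obtain ⟨rfl, rfl⟩ := Nat.pair_eq_pair.1 he
    exact ⟨(hE _).2 ⟨_, rfl⟩, (hTn _ _ _).2 hsat⟩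
  · intro he
    obtain ⟨φ, rfl⟩ := (hV e).1 he
    constructor
    · cases φ <;> simp [encodeB, hVφ]
    · intro hd
      obtain ⟨d, rfl⟩ := (hE d).1 hd
      refine ⟨?_, ?_, ?_, ?_⟩
      · cases φ <;> try (simp [encodeB]; done)
        rename_i ψ
        intro _
        rw [hTz, show (encodeB (neg ψ)).unpair.2 = encodeB ψ by simp [encodeB], hTn, PS_neg, not_not]
      · cases φ <;> try (simp [encodeB]; done)
        rename_i ψ χ
        intro _
        rw [hTn, show (encodeB (and ψ χ)).unpair.2.unpair.1 = encodeB ψ by simp [encodeB],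
          show (encodeB (and ψ χ)).unpair.2.unpair.2 = encodeB χ by simp [encodeB], hTn, hTn, PS_and]
      · cases φ <;> try (simp [encodeB]; done)
        rename_i ψ
        intro _
        rw [hTz, show (encodeB (dia0 ψ)).unpair.2 = encodeB ψ by simp [encodeB], hTn, hTz, hT]
        refine ⟨hT3 _ t d ψ w rfl, fun hn hw hc => hn ?_⟩
        rw [PS_dia0]
        exact ⟨w, hw, hc⟩
      · cases φ <;> try (simp [encodeB]; done)
        rename_i ψ
        intro _
        rw [hTz, show (encodeB (dia1 ψ)).unpair.2 = encodeB ψ by simp [encodeB], hT]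
        constructor
        · intro hw
          obtain ⟨d', rfl, hne, hp⟩ := hT4 _ t d ψ w rfl hw
          exact ⟨(hE _).2 ⟨_, rfl⟩, fun hc => hne (hι hc), (hTn _ _ _).2 hp⟩
        · intro hn hw hdw
          obtain ⟨d', rfl⟩ := (hE w).1 hw
          rw [hTz]
          intro hc
          exact hn ((hd1 _ _ _).2 ⟨d', fun h => hdw (congrArg ι h), hc⟩)

theorem BCodes_iff_good (n : ℕ) : BCodes OmegaDiffSat n ↔ ∃ f, GoodF n f := by
  constructor
  · intro h
    obtain ⟨V, E, T, s, H⟩ := good_of_sat n h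
    refine ⟨fun p => if p.unpair.1 = 0 then V p.unpair.2 else if p.unpair.1 = 1 then E p.unpair.2
      else if p.unpair.1 = 2 then T p.unpair.2.unpair.1 p.unpair.2.unpair.2.unpair.1
        p.unpair.2.unpair.2.unpair.2 else s, ?_⟩
    rw [GoodF_iff]
    intro e t d w
    have := H e t d w
    simpa only [tPos, Nat.unpair_pair, reduceIte, one_ne_zero, OfNat.ofNat_ne_zero,
      OfNat.ofNat_ne_one, Nat.reduceEqDiff] using this
  · rintro ⟨f, hf⟩
    exact sat_of_good n _ _ _ _ ((GoodF_iff n f).1 hf)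

theorem Sigma11_sat : Sigma11 (BCodes OmegaDiffSat) := by
  have : BCodes OmegaDiffSat = fun n => ∃ f, GoodF n f := funext fun n => propext (BCodes_iff_good n)
  rw [this]
  exact Sigma11_GoodF

theorem final_thm : Sigma11Complete (BCodes OmegaDiffSat) ∧
    ManyOneReducible CMRecur (BCodes OmegaDiffSat) :=
  ⟨⟨Sigma11_sat, fun B hB => (Sigma11_le_CMRecur B hB).trans CMRecur_le⟩, CMRecur_le⟩
end

/-- Satisfiability over products of `⟨ω,<⟩` with difference frames is
`Σ₁¹`-complete; in particular the counter-machine recurrence problem is computably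
many-one reducible to it. -/
theorem omegaDiff_sat_Sigma11_complete :
    Sigma11Complete (BCodes OmegaDiffSat) ∧
    ManyOneReducible CMRecur (BCodes OmegaDiffSat) := by
  exact final_thm

end HK
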